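/- arXiv:2309.12947 — 2 statements merged into one kernel-verified Lean document; each statement's English description precedes it below -/
import Mathlib

section
/- Let n ≥ 2 and let f : B → ℝⁿ \ {0} be a K-quasiregular mapping. If f belongs to the Bergman space A^p for some 0 < p < ∞, i.e. ∫_B |f(x)|^p dx < ∞, then for every 0 < p' < p(n−1)/n one has ∫₀¹ (1−r)^{n−2} M(r,f)^{p'} dr < ∞, where M(r,f) := sup_{|x|=r} |f(x)|. -/
open MeasureTheory Metric Set Filter
open scoped ENNReal NNReal Topology Classical

noncomputable section

abbrev Vec (n : ℕ) := EuclideanSpace ℝ (Fin n)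

/-- The open unit ball in `ℝⁿ`. -/
def unitBall (n : ℕ) : Set (Vec n) := Metric.ball 0 1

/-- The unit sphere `S^{n-1}` in `ℝⁿ`. -/
def unitSphere (n : ℕ) : Set (Vec n) := Metric.sphere 0 1

/-- Surface measure on the unit sphere, modelled by `(n-1)`-dimensional
Hausdorff measure restricted to the sphere. -/
def sphMeasure (n : ℕ) : Measure (Vec n) := (μH[(n : ℝ) - 1]).restrict (unitSphere n)

/-- `f` is `K`-quasiregular on the unit ball. -/
def IsQR (n : ℕ) (K : ℝ) (f : Vec n → Vec n) : Prop :=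
  ContinuousOn f (unitBall n) ∧
  (∀ x ∈ unitBall n, DifferentiableAt ℝ f x) ∧
  (∀ᵐ x ∂(volume.restrict (unitBall n)),
    ‖fderiv ℝ f x‖ ^ n ≤ K * (fderiv ℝ f x).det)

/-- The conformal automorphism `T_x` of the unit ball (with `T_0 = id`). -/
def mobiusT (n : ℕ) (x : Vec n) (y : Vec n) : Vec n :=
  if x = 0 then y
  else (‖x‖ ^ 2 * ‖y - (‖x‖ ^ 2)⁻¹ • x‖ ^ 2)⁻¹ •
    ((1 - ‖x‖ ^ 2) • (y - x) - ‖y - x‖ ^ 2 • x)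

/-- The Miniowitz class (Min) with constants `C₀, α`. -/
def InMiniowitz (n : ℕ) (C₀ α : ℝ) (f : Vec n → Vec n) : Prop :=
  ∀ x ∈ unitBall n, ∀ y ∈ unitBall n,
    C₀⁻¹ * ((1 - ‖y‖) / (1 + ‖y‖)) ^ α ≤ ‖f (mobiusT n (-x) y)‖ / ‖f (mobiusT n (-x) 0)‖ ∧
    ‖f (mobiusT n (-x) y)‖ / ‖f (mobiusT n (-x) 0)‖ ≤ C₀ * ((1 + ‖y‖) / (1 - ‖y‖)) ^ α

/-- The multiplicity condition (M) with exponent `a` and constant `C₁`. -/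
def MultCond (n : ℕ) (a C₁ : ℝ) (f : Vec n → Vec n) : Prop :=
  ∀ x ∈ unitBall n, ∀ r : ℝ, 0 < r → r < 1 → ∀ y : Vec n,
    (({z ∈ Metric.ball (0 : Vec n) r | f (mobiusT n (-x) z) = y}).encard : ℝ≥0∞) ≤
      ENNReal.ofReal (C₁ / (1 - r) ^ a)

/-- The non-tangential region `Γ(ω)` with aperture parameter `κ`. -/
def ntRegion (n : ℕ) (κ : ℝ) (ω : Vec n) : Set (Vec n) :=
  {x ∈ unitBall n | ‖x - ω‖ < (1 + κ) * (1 - ‖x‖)}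

/-- The non-tangential maximal function `f*`. -/
def ntMax (n : ℕ) (κ : ℝ) (f : Vec n → Vec n) (ω : Vec n) : ℝ≥0∞ :=
  ⨆ x ∈ ntRegion n κ ω, ENNReal.ofReal ‖f x‖

/-- `f` has the non-tangential limit `L` at `ω`. -/
def HasNTLimit (n : ℕ) (κ : ℝ) (f : Vec n → Vec n) (ω L : Vec n) : Prop :=
  Filter.Tendsto f (𝓝[ntRegion n κ ω] ω) (𝓝 L)

/-- The `p`-th mean of `f` on the sphere of radius `r`. -/
def hardyMean (n : ℕ) (p : ℝ) (f : Vec n → Vec n) (r : ℝ) : ℝ≥0∞ :=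
  (sphMeasure n (unitSphere n))⁻¹ *
    ∫⁻ ω, ENNReal.ofReal (‖f (r • ω)‖ ^ p) ∂(sphMeasure n)

/-- The Hardy `H^p` norm of `f` on the unit ball. -/
def hardyNorm (n : ℕ) (p : ℝ) (f : Vec n → Vec n) : ℝ≥0∞ :=
  (⨆ r ∈ Set.Ioo (0 : ℝ) 1, hardyMean n p f r) ^ (1 / p)

/-- `f` belongs to the Hardy space `H^p`. -/
def MemHp (n : ℕ) (p : ℝ) (f : Vec n → Vec n) : Prop := hardyNorm n p f < ⊤

/-- The `L^p(σ)` norm of a boundary function on the unit sphere. -/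
def lpSphere (n : ℕ) (p : ℝ) (g : Vec n → Vec n) : ℝ≥0∞ :=
  (∫⁻ ω, ENNReal.ofReal (‖g ω‖ ^ p) ∂(sphMeasure n)) ^ (1 / p)

/-- The `L^p(σ)` norm of the non-tangential maximal function `f*`. -/
def ntMaxLp (n : ℕ) (κ p : ℝ) (f : Vec n → Vec n) : ℝ≥0∞ :=
  (∫⁻ ω, (ntMax n κ f ω) ^ p ∂(sphMeasure n)) ^ (1 / p)

/-- `μ` is a Carleson measure on the unit ball with constant `c`. -/
def IsCarleson (n : ℕ) (c : ℝ) (μ : Measure (Vec n)) : Prop :=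
  ∀ ω ∈ unitSphere n, ∀ r : ℝ, 0 < r →
    μ (unitBall n ∩ Metric.ball ω r) ≤ ENNReal.ofReal c * ENNReal.ofReal r ^ ((n : ℝ) - 1)

/-- `μ` is an `α`-Carleson measure on the unit ball with constant `γ`. -/
def IsAlphaCarleson (n : ℕ) (α γ : ℝ) (μ : Measure (Vec n)) : Prop :=
  ∀ ω ∈ unitSphere n, ∀ r : ℝ, 0 < r →
    μ (unitBall n ∩ Metric.ball ω r) ≤
      ENNReal.ofReal γ * ENNReal.ofReal r ^ (α * ((n : ℝ) - 1))

open scoped Convolution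

/-- The determinant of `A` is a fixed linear combination of the values `det (1 + t A)` at finitely
many small `t`, with weights summing to zero. -/
theorem exists_weights_det {n : ℕ} (hn : 1 ≤ n) {δ : ℝ} (hδ : 0 < δ) :
    ∃ (s : Finset ℝ) (w : ℝ → ℝ), (∀ t ∈ s, 0 < t ∧ t < δ) ∧ ∑ t ∈ s, w t = 0 ∧
      ∀ A : Vec n →L[ℝ] Vec n, A.det = ∑ t ∈ s, w t * (1 + t • A).det := by
  obtain ⟨s, hs, hcard⟩ := (Ioo_infinite hδ).exists_subset_card_eq (n + 1)
  refine ⟨s, fun t => (∏ j ∈ s.erase t, (t - j))⁻¹, fun t ht => hs ht, ?_, fun A => ?_⟩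
  · have h := Lagrange.coeff_eq_sum (s := s) (v := id) Function.injective_id.injOn
      (P := (1 : Polynomial ℝ)) (by
        rw [Polynomial.degree_one, hcard]; exact_mod_cast Nat.succ_pos n)
    rw [hcard, Polynomial.coeff_one, if_neg (by omega)] at h
    simpa [div_eq_mul_inv] using h.symm
  · let b := (EuclideanSpace.basisFun (Fin n) ℝ).toBasis
    let M := LinearMap.toMatrix b b (A : Vec n →ₗ[ℝ] Vec n)
    let P := (Polynomial.X (R := ℝ) • M.map Polynomial.C
      + (1 : Matrix (Fin n) (Fin n) ℝ).map Polynomial.C).det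
    have hdeg : P.natDegree ≤ n :=
      (Polynomial.natDegree_det_X_add_C_le M 1).trans_eq (Fintype.card_fin n)
    have hcoeff : P.coeff n = M.det := by
      have := Polynomial.coeff_det_X_add_C_card M 1
      rwa [Fintype.card_fin] at this
    have hev (t : ℝ) : P.eval t = (1 + t • A).det := by
      have h1 : (1 + t • A).det
          = (LinearMap.toMatrix b b ((1 + t • A : Vec n →L[ℝ] Vec n) : Vec n →ₗ[ℝ] Vec n)).det :=
        (LinearMap.det_toMatrix b _).symm
      have h2 : LinearMap.toMatrix b b ((1 + t • A : Vec n →L[ℝ] Vec n) : Vec n →ₗ[ℝ] Vec n)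
          = t • M + 1 := by
        rw [add_comm, ContinuousLinearMap.toLinearMap_add, map_add,
          ContinuousLinearMap.toLinearMap_smul, map_smul]
        congr 1
        exact LinearMap.toMatrix_one b
      rw [h1, h2, ← Polynomial.coe_evalRingHom, RingHom.map_det]
      congr 1
      ext i j
      change Polynomial.eval t (Polynomial.X * Polynomial.C (M i j)
        + Polynomial.C ((1 : Matrix (Fin n) (Fin n) ℝ) i j))
          = t * M i j + (1 : Matrix (Fin n) (Fin n) ℝ) i j
      rw [Polynomial.eval_add, Polynomial.eval_mul, Polynomial.eval_X, Polynomial.eval_C,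
        Polynomial.eval_C]
    have h := Lagrange.coeff_eq_sum (s := s) (v := id) Function.injective_id.injOn (P := P) (by
        rw [hcard]
        exact (Polynomial.degree_le_of_natDegree_le hdeg).trans_lt (by exact_mod_cast n.lt_succ_self))
    rw [hcard, Nat.add_sub_cancel, hcoeff] at h
    rw [show A.det = M.det from (LinearMap.det_toMatrix b _).symm, h]
    refine Finset.sum_congr rfl fun t _ => ?_
    rw [id, hev, div_eq_inv_mul]
    rfl

/-- The Jacobian of a compactly supported `C¹` map has vanishing integral. -/
theorem integral_det_fderiv_eq_zero_of_contDiff {n : ℕ} (hn : 1 ≤ n) {h : Vec n → Vec n}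
    (hh : ContDiff ℝ 1 h) (hc : HasCompactSupport h) :
    ∫ x, (fderiv ℝ h x).det = 0 := by
  obtain ⟨L, hL⟩ := hh.lipschitzWith_of_hasCompactSupport hc one_ne_zero
  obtain ⟨R, hR⟩ := hc.isCompact.isBounded.subset_closedBall (0 : Vec n)
  have hdiff : Differentiable ℝ h := hh.differentiable one_ne_zero
  set S : Set (Vec n) := closedBall 0 R
  obtain ⟨δ₀, hδ₀, hdet⟩ : ∃ δ > 0, ∀ B : Vec n →L[ℝ] Vec n, dist B 1 < δ → 0 < B.det := by
    have hcont : ContinuousAt (fun B : Vec n →L[ℝ] Vec n => B.det) 1 :=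
      ContinuousLinearMap.continuous_det.continuousAt
    have h1 : (0 : ℝ) < (1 : Vec n →L[ℝ] Vec n).det := by
      have : (1 : Vec n →L[ℝ] Vec n).det = 1 := LinearMap.det_id
      rw [this]; norm_num
    exact Metric.eventually_nhds_iff.1 (hcont.eventually (lt_mem_nhds h1))
  set δ : ℝ := min δ₀ 1 / (L + 1)
  have hLpos : (0 : ℝ) < L + 1 := by positivity
  have hδ : 0 < δ := by positivity
  obtain ⟨s, w, hs, hw, hrep⟩ := exists_weights_det hn hδ
  have hnorm (x : Vec n) : ‖fderiv ℝ h x‖ ≤ L := norm_fderiv_le_of_lipschitz ℝ hL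
  have hsmall (t : ℝ) (ht : t ∈ s) : t * (L + 1) < min δ₀ 1 := (lt_div_iff₀ hLpos).1 (hs t ht).2
  have hvol (t : ℝ) (ht : t ∈ s) :
      ∫ x in S, (1 + t • fderiv ℝ h x).det = volume.real S := by
    have ht0 := (hs t ht).1
    have htL := hsmall t ht
    let F : Vec n → Vec n := fun x => x + t • h x
    have hF (x : Vec n) : HasFDerivAt F (1 + t • fderiv ℝ h x) x :=
      (hasFDerivAt_id x).add ((hdiff x).hasFDerivAt.const_smul t)
    have happ : ApproximatesLinearOn F
        ((ContinuousLinearEquiv.refl ℝ (Vec n) : Vec n ≃L[ℝ] Vec n) : Vec n →L[ℝ] Vec n) univ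
        (t.toNNReal * L) := by
      intro x _ y _
      have : F x - F y - (x - y) = t • (h x - h y) := by simp only [F, smul_sub]; abel
      simp only [ContinuousLinearEquiv.coe_refl, ContinuousLinearMap.coe_id', id]
      rw [this, norm_smul, Real.norm_of_nonneg ht0.le, NNReal.coe_mul,
        Real.coe_toNNReal _ ht0.le, mul_assoc]
      gcongr
      simpa [dist_eq_norm] using hL.dist_le_mul x y
    have hNt : Nontrivial (Vec n) := by
      have : Nonempty (Fin n) := ⟨⟨0, hn⟩⟩
      infer_instance
    have hlt : Subsingleton (Vec n) ∨ t.toNNReal * L <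
        ‖((ContinuousLinearEquiv.refl ℝ (Vec n)).symm : Vec n →L[ℝ] Vec n)‖₊⁻¹ := by
      right
      have : ‖((ContinuousLinearEquiv.refl ℝ (Vec n)).symm : Vec n →L[ℝ] Vec n)‖₊ = 1 := by
        ext; exact ContinuousLinearMap.norm_id
      rw [this, inv_one, ← NNReal.coe_lt_coe, NNReal.coe_mul, Real.coe_toNNReal _ ht0.le]
      have := htL.trans_le (min_le_right _ _)
      push_cast; nlinarith
    have hinj : Function.Injective F := fun x y hxy => by
      have := happ.injective hlt
      exact congrArg Subtype.val (@this ⟨x, mem_univ _⟩ ⟨y, mem_univ _⟩ hxy)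
    have hsurj : Function.Surjective F := happ.surjective hlt
    have hout (x : Vec n) (hx : x ∉ S) : F x = x := by
      have : h x = 0 := by
        by_contra hne
        exact hx (hR (subset_tsupport _ hne))
      simp [F, this]
    have himg : F '' S = S := by
      apply Subset.antisymm
      · rintro _ ⟨x, hx, rfl⟩
        by_contra hcon
        have := hinj (hout _ hcon)
        rw [this] at hcon
        exact hcon hx
      · intro y hy
        obtain ⟨x, rfl⟩ := hsurj y
        by_cases hx : x ∈ S
        · exact ⟨x, hx, rfl⟩
        · rw [hout x hx] at hy
          exact absurd hy hx
    have hpos (x : Vec n) : 0 < (1 + t • fderiv ℝ h x).det := by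
      apply hdet
      rw [dist_eq_norm, add_sub_cancel_left, norm_smul, Real.norm_of_nonneg ht0.le]
      have := htL.trans_le (min_le_left _ _)
      nlinarith [hnorm x]
    have key := integral_image_eq_integral_abs_det_fderiv_smul (volume : Measure (Vec n))
      (s := S) isClosed_closedBall.measurableSet (fun x _ => (hF x).hasFDerivWithinAt)
      hinj.injOn (fun _ => (1 : ℝ))
    rw [himg] at key
    simp only [smul_eq_mul, mul_one, abs_of_pos (hpos _)] at key
    rw [← key]; simp
  have hcontd : Continuous (fderiv ℝ h) := hh.continuous_fderiv one_ne_zero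
  have hinteg (t : ℝ) : IntegrableOn (fun x => (1 + t • fderiv ℝ h x).det) S := by
    apply ContinuousOn.integrableOn_compact (isCompact_closedBall _ _)
    apply Continuous.continuousOn
    exact ContinuousLinearMap.continuous_det.comp (continuous_const.add (hcontd.const_smul t))
  have hSall : ∫ x, (fderiv ℝ h x).det = ∫ x in S, (fderiv ℝ h x).det := by
    symm
    apply setIntegral_eq_integral_of_forall_compl_eq_zero
    intro x hx
    have hx0 : fderiv ℝ h x = 0 := by
      by_contra hne
      exact hx (hR (support_fderiv_subset ℝ hne))
    rw [hx0]
    have : Nonempty (Fin n) := ⟨⟨0, hn⟩⟩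
    exact LinearMap.det_zero'' (M := Vec n)
  rw [hSall]
  rw [setIntegral_congr_fun isClosed_closedBall.measurableSet fun x _ => hrep (fderiv ℝ h x)]
  rw [integral_finsetSum _ fun t _ => (hinteg t).const_mul _]
  simp_rw [integral_const_mul]
  rw [Finset.sum_congr rfl fun t ht => by rw [hvol t ht], ← Finset.sum_mul, hw, zero_mul]

/-- The determinant of the matrix whose rows are the functionals `L i`. -/
def rowDet {n : ℕ} (L : Fin n → (Vec n →L[ℝ] ℝ)) : ℝ :=
  Matrix.det (Matrix.of fun i j => L i (EuclideanSpace.single j 1))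

theorem abs_rowDet_le {n : ℕ} (L : Fin n → (Vec n →L[ℝ] ℝ)) :
    |rowDet L| ≤ n.factorial * ∏ i, ‖L i‖ := by
  rw [rowDet, ← Matrix.det_transpose, Matrix.det_apply]
  refine (Finset.abs_sum_le_sum_abs _ _).trans ?_
  have (σ : Equiv.Perm (Fin n)) : |Equiv.Perm.sign σ •
      ∏ i, (Matrix.of fun i j => L i (EuclideanSpace.single j 1)).transpose (σ i) i| ≤ ∏ i, ‖L i‖ := by
    have h1 : |Equiv.Perm.sign σ •
      ∏ i, (Matrix.of fun i j => L i (EuclideanSpace.single j 1)).transpose (σ i) i|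
        = ∏ i, |L i (EuclideanSpace.single (σ i) 1)| := by
      rcases Int.units_eq_one_or (Equiv.Perm.sign σ) with h | h <;>
        simp [h, Finset.abs_prod, Matrix.transpose_apply]
    rw [h1]
    refine Finset.prod_le_prod (fun _ _ => abs_nonneg _) fun i _ => ?_
    simpa using (L i).le_opNorm (EuclideanSpace.single (σ i) (1 : ℝ))
  refine (Finset.sum_le_sum fun σ _ => this σ).trans ?_
  simp [Finset.card_univ, Fintype.card_perm]

/-- The `i`-th coordinate functional composed with `A`. -/
def rowOf {n : ℕ} (A : Vec n →L[ℝ] Vec n) (i : Fin n) : Vec n →L[ℝ] ℝ :=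
  (EuclideanSpace.proj i : Vec n →L[ℝ] ℝ).comp A

theorem norm_rowOf_le {n : ℕ} (A : Vec n →L[ℝ] Vec n) (i : Fin n) : ‖rowOf A i‖ ≤ ‖A‖ := by
  refine ContinuousLinearMap.opNorm_le_bound _ (norm_nonneg _) fun x => ?_
  exact (PiLp.norm_apply_le (A x) i).trans (A.le_opNorm x)

theorem det_eq_rowDet {n : ℕ} (A : Vec n →L[ℝ] Vec n) : A.det = rowDet (rowOf A) := by
  let b := (EuclideanSpace.basisFun (Fin n) ℝ).toBasis
  have h1 : A.det = (LinearMap.toMatrix b b (A : Vec n →ₗ[ℝ] Vec n)).det :=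
    (LinearMap.det_toMatrix b _).symm
  rw [h1, rowDet]
  congr 1

theorem abs_det_le {n : ℕ} (A : Vec n →L[ℝ] Vec n) : |A.det| ≤ n.factorial * ‖A‖ ^ n := by
  rw [det_eq_rowDet]
  refine (abs_rowDet_le _).trans ?_
  gcongr
  refine (Finset.prod_le_prod (fun _ _ => norm_nonneg _) fun i _ => norm_rowOf_le A i).trans ?_
  simp

/-- One half of the generalized dominated convergence theorem. -/
theorem integral_nonneg_of_dominated {α : Type*} [MeasurableSpace α] {μ : Measure α}
    {F : ℕ → α → ℝ} {f : α → ℝ} {G : ℕ → α → ℝ} {g : α → ℝ}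
    (hF : ∀ k, Integrable (F k) μ) (hf : Integrable f μ) (hG : ∀ k, Integrable (G k) μ)
    (hg : Integrable g μ) (hFG : ∀ k x, |F k x| ≤ G k x)
    (hFf : ∀ᵐ x ∂μ, Tendsto (fun k => F k x) atTop (𝓝 (f x)))
    (hGg : ∀ᵐ x ∂μ, Tendsto (fun k => G k x) atTop (𝓝 (g x)))
    (hF0 : ∀ k, ∫ x, F k x ∂μ = 0) (hGint : ∀ k, ∫ x, G k x ∂μ = ∫ x, g x ∂μ) :
    0 ≤ ∫ x, f x ∂μ := by
  have hae : ∀ᵐ x ∂μ, ENNReal.ofReal (g x - f x)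
      = liminf (fun k => ENNReal.ofReal (G k x - F k x)) atTop := by
    filter_upwards [hFf, hGg] with x h1 h2
    exact ((ENNReal.continuous_ofReal.tendsto _).comp (h2.sub h1)).liminf_eq.symm
  have hle : ∫⁻ x, ENNReal.ofReal (g x - f x) ∂μ ≤ ENNReal.ofReal (∫ x, g x ∂μ) := by
    rw [lintegral_congr_ae hae]
    refine (lintegral_liminf_le' fun k =>
      ((hG k).sub (hF k)).aestronglyMeasurable.aemeasurable.ennreal_ofReal).trans ?_
    refine liminf_le_of_le (by isBoundedDefault) fun b hb => ?_
    obtain ⟨k, hk⟩ := hb.exists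
    refine hk.trans_eq ?_
    simp_rw [Pi.sub_apply]
    rw [← ofReal_integral_eq_lintegral_ofReal (f := fun x => G k x - F k x) ((hG k).sub (hF k))
      (Eventually.of_forall fun x => sub_nonneg.2 ((le_abs_self _).trans (hFG k x))),
      ← hGint k]
    congr 1
    rw [integral_sub (hG k) (hF k), hF0, sub_zero]
  have hnn : 0 ≤ᵐ[μ] fun x => g x - f x := by
    filter_upwards [hFf, hGg] with x h1 h2
    exact sub_nonneg.2 (le_of_tendsto_of_tendsto' h1 h2 fun k => (le_abs_self _).trans (hFG k x))
  rw [← ofReal_integral_eq_lintegral_ofReal (f := fun x => g x - f x) (hg.sub hf) hnn] at hle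
  have hg0 : 0 ≤ ∫ x, g x ∂μ := by
    rw [← hGint 0]
    exact integral_nonneg fun x => (abs_nonneg _).trans (hFG 0 x)
  have := (ENNReal.ofReal_le_ofReal_iff hg0).1 hle
  rw [integral_sub hg hf] at this
  linarith

theorem integrable_normed_smul_comp_sub {n : ℕ} {F : Type*} [NormedAddCommGroup F]
    [NormedSpace ℝ F] (φ : ContDiffBump (0 : Vec n)) {g : Vec n → F}
    (hg : Integrable g) (x : Vec n) :
    Integrable (fun t => φ.normed volume t • g (x - t)) := by
  obtain ⟨C, hC⟩ := φ.hasCompactSupport_normed.exists_bound_of_continuous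
    (φ.continuous_normed (μ := volume))
  exact (hg.comp_sub_left x).bdd_smul C φ.continuous_normed.aestronglyMeasurable
    (Eventually.of_forall hC)

theorem fderiv_normed_convolution {n : ℕ} {h : Vec n → Vec n}
    (φ : ContDiffBump (0 : Vec n)) (hd : Differentiable ℝ h) (hc : HasCompactSupport h)
    (hi : Integrable (fderiv ℝ h)) (x : Vec n) :
    fderiv ℝ (φ.normed volume ⋆[ContinuousLinearMap.lsmul ℝ ℝ, volume] h) x
      = (φ.normed volume ⋆[ContinuousLinearMap.lsmul ℝ ℝ, volume] fderiv ℝ h) x := by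
  have hinteg : Integrable h := hd.continuous.integrable_of_hasCompactSupport hc
  have hφ1 : ContDiff ℝ 1 (φ.normed (volume : Measure (Vec n))) := φ.contDiff_normed
  have hφc := φ.hasCompactSupport_normed (μ := volume)
  rw [(hφc.hasFDerivAt_convolution_left (ContinuousLinearMap.lsmul ℝ ℝ) hφ1
    hinteg.locallyIntegrable x).fderiv]
  ext1 v
  obtain ⟨C, hC⟩ := (hφc.fderiv ℝ).exists_bound_of_continuous (hφ1.continuous_fderiv one_ne_zero)
  have hi1 : Integrable (fun t => fderiv ℝ (φ.normed (volume : Measure (Vec n))) t v • h (x - t)) := by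
    have hm : AEStronglyMeasurable
        (fun t => fderiv ℝ (φ.normed (volume : Measure (Vec n))) t v) volume :=
      ((hφ1.continuous_fderiv one_ne_zero).clm_apply continuous_const).aestronglyMeasurable
    exact (hinteg.comp_sub_left x).bdd_smul (C * ‖v‖) hm (Eventually.of_forall fun t =>
      (ContinuousLinearMap.le_opNorm _ _).trans (by gcongr; exact hC t))
  have hi2 := integrable_normed_smul_comp_sub φ hi x
  have hder (t : Vec n) : fderiv ℝ (fun s => h (x - s)) t = -fderiv ℝ h (x - t) := by
    have h1 : HasFDerivAt (fun s : Vec n => x - s) (-ContinuousLinearMap.id ℝ (Vec n)) t :=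
      (hasFDerivAt_id t).const_sub x
    have h2 : HasFDerivAt (fun s => h (x - s))
        ((fderiv ℝ h (x - t)).comp (-ContinuousLinearMap.id ℝ (Vec n))) t :=
      (hd (x - t)).hasFDerivAt.comp t h1
    rw [h2.fderiv]
    ext; simp
  have ibp := integral_smul_fderiv_eq_neg_fderiv_smul_of_integrable (μ := volume)
    (f := φ.normed volume) (g := fun t => h (x - t)) (v := v) hi1
    (by
      simp_rw [hder]
      simpa using ((hi2.apply_continuousLinearMap v).neg))
    (integrable_normed_smul_comp_sub φ hinteg x)
    (fun t _ => hφ1.differentiable one_ne_zero t)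
    (fun t _ => (hd _).comp t (by fun_prop))
  simp_rw [hder] at ibp
  rw [convolution_def, convolution_def]
  simp only [ContinuousLinearMap.lsmul_apply]
  rw [ContinuousLinearMap.integral_apply hi2]
  have hex : ConvolutionExistsAt (fderiv ℝ (φ.normed (volume : Measure (Vec n)))) h x
      (ContinuousLinearMap.precompL (Vec n) (ContinuousLinearMap.lsmul ℝ ℝ)) volume :=
    HasCompactSupport.convolutionExists_left _ (hφc.fderiv ℝ)
      (hφ1.continuous_fderiv one_ne_zero) hinteg.locallyIntegrable x
  rw [ContinuousLinearMap.integral_apply hex.integrable]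
  simp only [ContinuousLinearMap.precompL_apply, ContinuousLinearMap.lsmul_apply, smul_apply]
  rw [← neg_eq_iff_eq_neg] at ibp
  rw [← ibp, ← integral_neg]
  congr 1; ext1 t; simp

theorem integral_smul_pow_le {α : Type*} [MeasurableSpace α] {μ : Measure α} {φ u : α → ℝ}
    (m : ℕ) (hφ : Measurable φ) (hφ0 : ∀ t, 0 ≤ φ t) (hφi : Integrable φ μ)
    (hφ1 : ∫ t, φ t ∂μ = 1) (hu0 : ∀ t, 0 ≤ u t) (hu : Integrable (fun t => φ t • u t) μ)
    (hum : Integrable (fun t => φ t • u t ^ m) μ) :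
    (∫ t, φ t • u t ∂μ) ^ m ≤ ∫ t, φ t • u t ^ m ∂μ := by
  have hmeas : Measurable fun t => (φ t).toNNReal := hφ.real_toNNReal
  have hconv (t : α) (y : ℝ) : (φ t).toNNReal • y = φ t • y := by
    rw [NNReal.smul_def, Real.coe_toNNReal _ (hφ0 t)]
  have hν : IsProbabilityMeasure (μ.withDensity fun t => ((φ t).toNNReal : ℝ≥0∞)) := by
    constructor
    rw [withDensity_apply _ MeasurableSet.univ, Measure.restrict_univ]
    change ∫⁻ t, ENNReal.ofReal (φ t) ∂μ = 1
    rw [← ofReal_integral_eq_lintegral_ofReal hφi (Eventually.of_forall hφ0), hφ1,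
      ENNReal.ofReal_one]
  have hj := (convexOn_pow m).map_integral_le
    (μ := μ.withDensity fun t => ((φ t).toNNReal : ℝ≥0∞)) (f := u)
    (continuous_pow m).continuousOn isClosed_Ici (Eventually.of_forall hu0)
    (by
      rw [integrable_withDensity_iff_integrable_smul hmeas]
      simpa only [hconv] using hu)
    (by
      rw [integrable_withDensity_iff_integrable_smul hmeas]
      simpa only [hconv, Function.comp_def] using hum)
  rw [integral_withDensity_eq_integral_smul hmeas, integral_withDensity_eq_integral_smul hmeas]
    at hj
  simpa only [hconv] using hj

theorem norm_convolution_pow_le {n : ℕ} {F : Type*} [NormedAddCommGroup F] [NormedSpace ℝ F]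
    (φ : ContDiffBump (0 : Vec n)) {g : Vec n → F} (m : ℕ)
    (hg : Integrable g) (hgm : Integrable fun x => ‖g x‖ ^ m) (x : Vec n) :
    ‖(φ.normed volume ⋆[ContinuousLinearMap.lsmul ℝ ℝ, volume] g) x‖ ^ m
      ≤ (φ.normed volume ⋆[ContinuousLinearMap.lsmul ℝ ℝ, volume] fun x => ‖g x‖ ^ m) x := by
  have hj := integral_smul_pow_le (u := fun t => ‖g (x - t)‖) m
    (φ.continuous_normed (μ := volume)).measurable φ.nonneg_normed φ.integrable_normed
    φ.integral_normed (fun t => norm_nonneg _) (integrable_normed_smul_comp_sub φ hg.norm x)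
    (integrable_normed_smul_comp_sub φ hgm x)
  rw [convolution_def, convolution_def]
  simp only [ContinuousLinearMap.lsmul_apply]
  refine le_trans ?_ hj
  gcongr
  refine (norm_integral_le_integral_norm _).trans_eq ?_
  congr 1; ext1 t
  rw [norm_smul, Real.norm_of_nonneg (φ.nonneg_normed t), smul_eq_mul]

/-- The Jacobian of a compactly supported everywhere differentiable map with `|Dh|ⁿ` integrable has
vanishing integral. -/
theorem integral_det_fderiv_eq_zero {n : ℕ} (hn : 1 ≤ n) {h : Vec n → Vec n}
    (hd : Differentiable ℝ h) (hc : HasCompactSupport h)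
    (hi : Integrable fun x => ‖fderiv ℝ h x‖ ^ n) :
    ∫ x, (fderiv ℝ h x).det = 0 := by
  have hm : StronglyMeasurable (fderiv ℝ h) := (measurable_fderiv ℝ h).stronglyMeasurable
  have hi1 : Integrable (fderiv ℝ h) := by
    have hb : Integrable (fun x => (tsupport h).indicator (fun _ => (1 : ℝ)) x
        + ‖fderiv ℝ h x‖ ^ n) := by
      refine Integrable.add ?_ hi
      exact (integrable_indicator_iff (isClosed_tsupport h).measurableSet).2
        (integrableOn_const hc.isCompact.measure_lt_top.ne)
    refine hb.mono' hm.aestronglyMeasurable (Eventually.of_forall fun x => ?_)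
    by_cases hx : x ∈ tsupport h
    · rw [indicator_of_mem hx]
      rcases le_total ‖fderiv ℝ h x‖ 1 with h1 | h1
      · have : 0 ≤ ‖fderiv ℝ h x‖ ^ n := by positivity
        linarith
      · linarith [le_self_pow₀ h1 (by omega : n ≠ 0)]
    · have : fderiv ℝ h x = 0 := by
        by_contra hne
        exact hx (support_fderiv_subset ℝ hne)
      rw [this, indicator_of_notMem hx, norm_zero]
      positivity
  have hinteg : Integrable h := hd.continuous.integrable_of_hasCompactSupport hc
  let φ (k : ℕ) : ContDiffBump (0 : Vec n) :=
    ⟨1 / (k + 1), 2 / (k + 1), by positivity, by gcongr; norm_num⟩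
  have hφlim : Tendsto (fun k => (φ k).rOut) atTop (𝓝 0) := by
    have := (tendsto_one_div_add_atTop_nhds_zero_nat (𝕜 := ℝ)).const_mul 2
    simpa [φ, div_eq_mul_inv] using this
  have hφratio : ∀ᶠ k in atTop, (φ k).rOut ≤ 2 * (φ k).rIn :=
    Eventually.of_forall fun k => by simp [φ, div_eq_mul_inv]
  let hk (k : ℕ) := (φ k).normed volume ⋆[ContinuousLinearMap.lsmul ℝ ℝ, volume] h
  have hkC (k : ℕ) : ContDiff ℝ 1 (hk k) :=
    (φ k).hasCompactSupport_normed.contDiff_convolution_left _ (φ k).contDiff_normed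
      hinteg.locallyIntegrable
  have hkc (k : ℕ) : HasCompactSupport (hk k) :=
    (φ k).hasCompactSupport_normed.convolution _ hc
  have hkd (k : ℕ) (x : Vec n) : fderiv ℝ (hk k) x
      = ((φ k).normed volume ⋆[ContinuousLinearMap.lsmul ℝ ℝ, volume] fderiv ℝ h) x :=
    fderiv_normed_convolution (φ k) hd hc hi1 x
  let G (k : ℕ) (x : Vec n) : ℝ := n.factorial *
    ((φ k).normed volume ⋆[ContinuousLinearMap.lsmul ℝ ℝ, volume]
      fun x => ‖fderiv ℝ h x‖ ^ n) x
  have hconvint (k : ℕ) : Integrable ((φ k).normed volume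
      ⋆[ContinuousLinearMap.lsmul ℝ ℝ, volume] fun x => ‖fderiv ℝ h x‖ ^ n) :=
    (φ k).integrable_normed.integrable_convolution _ hi
  have hFk (k : ℕ) : Integrable fun x => (fderiv ℝ (hk k) x).det := by
    refine Continuous.integrable_of_hasCompactSupport
      (ContinuousLinearMap.continuous_det.comp ((hkC k).continuous_fderiv one_ne_zero))
      (((hkc k).fderiv ℝ).comp_left (g := fun A : Vec n →L[ℝ] Vec n => A.det) ?_)
    have : Nonempty (Fin n) := ⟨⟨0, hn⟩⟩
    exact LinearMap.det_zero'' (M := Vec n)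
  have hf : Integrable fun x => (fderiv ℝ h x).det :=
    (hi.const_mul (n.factorial : ℝ)).mono'
      (ContinuousLinearMap.continuous_det.comp_aestronglyMeasurable hm.aestronglyMeasurable)
      (Eventually.of_forall fun x => abs_det_le _)
  have hdom (k : ℕ) (x : Vec n) : |(fderiv ℝ (hk k) x).det| ≤ G k x := by
    refine (abs_det_le _).trans ?_
    simp only [G]
    gcongr
    rw [hkd]
    exact norm_convolution_pow_le (φ k) n hi1 hi x
  have hlim : ∀ᵐ x, Tendsto (fun k => (fderiv ℝ (hk k) x).det) atTop (𝓝 (fderiv ℝ h x).det) := by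
    filter_upwards [ContDiffBump.ae_convolution_tendsto_right_of_locallyIntegrable
      (μ := (volume : Measure (Vec n))) hφlim hφratio hi1.locallyIntegrable] with x hx
    simp_rw [hkd]
    exact (ContinuousLinearMap.continuous_det.tendsto _).comp hx
  have hGlim : ∀ᵐ x, Tendsto (fun k => G k x) atTop (𝓝 (n.factorial * ‖fderiv ℝ h x‖ ^ n)) := by
    filter_upwards [ContDiffBump.ae_convolution_tendsto_right_of_locallyIntegrable
      (μ := (volume : Measure (Vec n))) hφlim hφratio hi.locallyIntegrable] with x hx
    exact hx.const_mul _
  have hGint (k : ℕ) : ∫ x, G k x = ∫ x, n.factorial * ‖fderiv ℝ h x‖ ^ n := by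
    simp only [G]
    rw [integral_const_mul, integral_const_mul, integral_convolution _ (φ k).integrable_normed hi,
      (φ k).integral_normed]
    simp
  have hzero (k : ℕ) : ∫ x, (fderiv ℝ (hk k) x).det = 0 :=
    integral_det_fderiv_eq_zero_of_contDiff hn (hkC k) (hkc k)
  apply le_antisymm
  · have := integral_nonneg_of_dominated (fun k => (hFk k).neg) hf.neg
      (fun k => (hconvint k).const_mul _) (hi.const_mul _) (G := G)
      (fun k x => by rw [Pi.neg_apply, abs_neg]; exact hdom k x)
      (hlim.mono fun x hx => hx.neg) hGlim
      (fun k => by rw [integral_neg', hzero, neg_zero]) hGint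
    rw [integral_neg'] at this
    linarith
  · exact integral_nonneg_of_dominated hFk hf (fun k => (hconvint k).const_mul _)
      (hi.const_mul _) hdom hlim hGlim hzero hGint

theorem differentiable_of_tsupport {n : ℕ} {F : Type*} [NormedAddCommGroup F] [NormedSpace ℝ F]
    {g : Vec n → F} (h : ∀ x ∈ tsupport g, DifferentiableAt ℝ g x) : Differentiable ℝ g := by
  intro x
  by_cases hx : x ∈ tsupport g
  · exact h x hx
  · exact (differentiableAt_const (0 : F)).congr_of_eventuallyEq
      (notMem_tsupport_iff_eventuallyEq.1 hx)

theorem mul_pow_pred_mul_le {n : ℕ} (hn : 1 ≤ n) {C ε a b : ℝ} (hC : 0 ≤ C) (hε : 0 < ε)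
    (ha : 0 ≤ a) (hb : 0 ≤ b) :
    C * a ^ (n - 1) * b ≤ ε * a ^ n + C * (C / ε) ^ (n - 1) * b ^ n := by
  obtain ⟨m, rfl⟩ : ∃ m, n = m + 1 := ⟨n - 1, by omega⟩
  simp only [Nat.add_sub_cancel]
  rcases le_total (C * b) (ε * a) with h | h
  · calc C * a ^ m * b = a ^ m * (C * b) := by ring
      _ ≤ a ^ m * (ε * a) := by gcongr
      _ = ε * a ^ (m + 1) := by ring
      _ ≤ _ := le_add_of_nonneg_right (by positivity)
  · have h1 : a ≤ C / ε * b := by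
      rw [div_mul_eq_mul_div, le_div_iff₀ hε]; linarith
    calc C * a ^ m * b ≤ C * (C / ε * b) ^ m * b := by gcongr
      _ = C * (C / ε) ^ m * b ^ (m + 1) := by rw [mul_pow]; ring
      _ ≤ _ := le_add_of_nonneg_left (by positivity)

theorem norm_le_sum_norm_rowOf {n : ℕ} (A : Vec n →L[ℝ] Vec n) : ‖A‖ ≤ ∑ j, ‖rowOf A j‖ := by
  refine A.opNorm_le_bound (Finset.sum_nonneg fun _ _ => norm_nonneg _) fun x => ?_
  have h : A x = ∑ j, (rowOf A j x) • EuclideanSpace.single j (1 : ℝ) := by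
    conv_lhs => rw [← (EuclideanSpace.basisFun (Fin n) ℝ).sum_repr (A x)]
    simp [rowOf]
  rw [h, Finset.sum_mul]
  refine (norm_sum_le _ _).trans (Finset.sum_le_sum fun j _ => ?_)
  rw [norm_smul, PiLp.norm_single, norm_one, mul_one]
  exact (rowOf A j).le_opNorm x

theorem rowDet_update_add_smul {n : ℕ} (L : Fin n → (Vec n →L[ℝ] ℝ)) (i : Fin n) (a b : ℝ)
    (P Q : Vec n →L[ℝ] ℝ) :
    rowDet (Function.update L i (a • P + b • Q))
      = a * rowDet (Function.update L i P) + b * rowDet (Function.update L i Q) := by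
  have key (R : Vec n →L[ℝ] ℝ) : rowDet (Function.update L i R)
      = ((Matrix.of fun i j => L i (EuclideanSpace.single j 1)).updateRow i
          fun j => R (EuclideanSpace.single j 1)).det := by
    rw [rowDet]
    congr 1
    ext k j
    by_cases h : k = i
    · subst h; simp
    · simp [h]
  rw [key, key, key]
  have : (fun j => (a • P + b • Q) (EuclideanSpace.single j 1))
      = a • (fun j => P (EuclideanSpace.single j 1)) + b • (fun j => Q (EuclideanSpace.single j 1)) := by
    ext j; simp
  rw [this, Matrix.det_updateRow_add, Matrix.det_updateRow_smul, Matrix.det_updateRow_smul]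

theorem rowDet_eq_zero {n : ℕ} {L : Fin n → (Vec n →L[ℝ] ℝ)} {i : Fin n} (h : L i = 0) :
    rowDet L = 0 :=
  Matrix.det_eq_zero_of_row_eq_zero i fun j => by simp [h]

theorem abs_rowDet_update_le {n : ℕ} (A : Vec n →L[ℝ] Vec n) (i : Fin n) (P : Vec n →L[ℝ] ℝ) :
    |rowDet (Function.update (rowOf A) i P)| ≤ n.factorial * (‖P‖ * ‖A‖ ^ (n - 1)) := by
  refine (abs_rowDet_le _).trans ?_
  gcongr
  rw [← Finset.mul_prod_erase _ _ (Finset.mem_univ i), Function.update_self]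
  gcongr
  refine (Finset.prod_le_prod (fun _ _ => norm_nonneg _) (g := fun _ => ‖A‖) fun j hj => ?_).trans_eq ?_
  · rw [Function.update_of_ne (Finset.ne_of_mem_erase hj)]
    exact norm_rowOf_le A j
  · simp [Finset.card_erase_of_mem]

/-- `f` is differentiable on the open set `U` and satisfies the `K`-distortion inequality there. -/
structure QROn (n : ℕ) (K : ℝ) (U : Set (Vec n)) (f : Vec n → Vec n) : Prop where
  isOpen : IsOpen U
  differentiableAt : ∀ x ∈ U, DifferentiableAt ℝ f x
  distortion : ∀ᵐ x, x ∈ U → ‖fderiv ℝ f x‖ ^ n ≤ K * (fderiv ℝ f x).det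

/-- The map with `i`-th coordinate `φⁿ v(f_i)` and the other coordinates `χ f_j`. -/
def testMap {n : ℕ} (φ χ : Vec n → ℝ) (f : Vec n → Vec n) (v : ℝ → ℝ) (i : Fin n) :
    Vec n → Vec n :=
  fun x => WithLp.toLp 2 fun j => if j = i then φ x ^ n * v (f x i) else χ x * f x j

theorem hasFDerivAt_rowOf {n : ℕ} {f : Vec n → Vec n} {x : Vec n} (hf : DifferentiableAt ℝ f x)
    (j : Fin n) : HasFDerivAt (fun y => f y j) (rowOf (fderiv ℝ f x) j) x :=
  (EuclideanSpace.proj j : Vec n →L[ℝ] ℝ).hasFDerivAt.comp x hf.hasFDerivAt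

section

variable {n : ℕ} {φ χ : Vec n → ℝ} {f : Vec n → Vec n} {v v' : ℝ → ℝ} {x : Vec n}

theorem hasFDerivAt_testMap_self (hf : DifferentiableAt ℝ f x) (hφ : DifferentiableAt ℝ φ x)
    (i : Fin n) (hv : ∀ s, HasDerivAt v (v' s) s) :
    HasFDerivAt (fun y => testMap φ χ f v i y i)
      ((n * φ x ^ (n - 1) * v (f x i)) • fderiv ℝ φ x
        + (φ x ^ n * v' (f x i)) • rowOf (fderiv ℝ f x) i) x := by
  simp only [testMap, if_true]
  refine ((hφ.hasFDerivAt.pow n).mul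
    ((hv (f x i)).comp_hasFDerivAt x (hasFDerivAt_rowOf hf i))).congr_fderiv ?_
  ext y
  simp
  ring

theorem hasFDerivAt_testMap_of_ne (hf : DifferentiableAt ℝ f x) (hχ : DifferentiableAt ℝ χ x)
    {i j : Fin n} (hij : j ≠ i) :
    HasFDerivAt (fun y => testMap φ χ f v i y j)
      (χ x • rowOf (fderiv ℝ f x) j + f x j • fderiv ℝ χ x) x := by
  simp only [testMap, if_neg hij]
  exact hχ.hasFDerivAt.mul (hasFDerivAt_rowOf hf j)

theorem differentiableAt_testMap (hf : DifferentiableAt ℝ f x) (hφ : DifferentiableAt ℝ φ x)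
    (hχ : DifferentiableAt ℝ χ x) (i : Fin n) (hv : ∀ s, HasDerivAt v (v' s) s) :
    DifferentiableAt ℝ (testMap φ χ f v i) x := by
  rw [differentiableAt_euclidean]
  intro j
  by_cases hij : j = i
  · subst hij
    exact (hasFDerivAt_testMap_self hf hφ j hv).differentiableAt
  · exact (hasFDerivAt_testMap_of_ne hf hχ hij).differentiableAt

theorem det_fderiv_testMap (hn : 2 ≤ n) (hf : DifferentiableAt ℝ f x)
    (hφ : DifferentiableAt ℝ φ x)
    (hχ : DifferentiableAt ℝ χ x) (i : Fin n) (hv : ∀ s, HasDerivAt v (v' s) s)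
    (hχ1 : φ x ≠ 0 → χ =ᶠ[𝓝 x] 1) :
    (fderiv ℝ (testMap φ χ f v i) x).det = (n * φ x ^ (n - 1) * v (f x i)) *
        rowDet (Function.update (rowOf (fderiv ℝ f x)) i (fderiv ℝ φ x))
      + (φ x ^ n * v' (f x i)) * (fderiv ℝ f x).det := by
  have hd := differentiableAt_testMap hf hφ hχ i hv
  have hi : rowOf (fderiv ℝ (testMap φ χ f v i) x) i = _ :=
    (hasFDerivAt_rowOf hd i).unique (hasFDerivAt_testMap_self (χ := χ) hf hφ i hv)
  rw [det_eq_rowDet]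
  by_cases h0 : φ x = 0
  · rw [rowDet_eq_zero (i := i)]
    · simp [h0, show n ≠ 0 by omega, show n - 1 ≠ 0 by omega]
    · rw [hi]
      simp [h0, show n ≠ 0 by omega, show n - 1 ≠ 0 by omega]
  · have hne (j : Fin n) (hj : j ≠ i) :
        rowOf (fderiv ℝ (testMap φ χ f v i) x) j = rowOf (fderiv ℝ f x) j := by
      rw [(hasFDerivAt_rowOf hd j).unique (hasFDerivAt_testMap_of_ne hf hχ hj),
        (hχ1 h0).fderiv_eq, (hχ1 h0).self_of_nhds]
      simp [Pi.one_def]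
    have : rowOf (fderiv ℝ (testMap φ χ f v i) x)
        = Function.update (rowOf (fderiv ℝ f x)) i
          ((n * φ x ^ (n - 1) * v (f x i)) • fderiv ℝ φ x
          + (φ x ^ n * v' (f x i)) • rowOf (fderiv ℝ f x) i) := by
      ext1 j
      by_cases hj : j = i
      · subst hj; rw [Function.update_self, hi]
      · rw [Function.update_of_ne hj, hne j hj]
    rw [this, rowDet_update_add_smul, Function.update_eq_self, det_eq_rowDet]

theorem norm_fderiv_testMap_le (hf : DifferentiableAt ℝ f x) (hφ : DifferentiableAt ℝ φ x)
    (hχ : DifferentiableAt ℝ χ x) (i : Fin n) (hv : ∀ s, HasDerivAt v (v' s) s) {M : ℝ}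
    (h1 : |n * φ x ^ (n - 1) * v (f x i)| * ‖fderiv ℝ φ x‖ ≤ M) (h2 : |φ x ^ n * v' (f x i)| ≤ M)
    (h3 : |χ x| ≤ M) (h4 : ‖f x‖ * ‖fderiv ℝ χ x‖ ≤ M) :
    ‖fderiv ℝ (testMap φ χ f v i) x‖ ≤ n * (M * (1 + ‖fderiv ℝ f x‖)) := by
  have hd := differentiableAt_testMap hf hφ hχ i hv
  refine (norm_le_sum_norm_rowOf _).trans ?_
  have hb (j : Fin n) : ‖rowOf (fderiv ℝ (testMap φ χ f v i) x) j‖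
      ≤ M * (1 + ‖fderiv ℝ f x‖) := by
    by_cases hij : j = i
    · subst hij
      rw [(hasFDerivAt_rowOf hd j).unique (hasFDerivAt_testMap_self hf hφ j hv), mul_add, mul_one]
      refine (norm_add_le _ _).trans (add_le_add ?_ ?_)
      · rwa [norm_smul]
      · rw [norm_smul]
        exact mul_le_mul h2 (norm_rowOf_le _ _) (norm_nonneg _) ((abs_nonneg _).trans h2)
    · rw [(hasFDerivAt_rowOf hd j).unique (hasFDerivAt_testMap_of_ne hf hχ hij), mul_add, mul_one,
        add_comm M]
      refine (norm_add_le _ _).trans (add_le_add ?_ ?_)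
      · rw [norm_smul]
        exact mul_le_mul h3 (norm_rowOf_le _ _) (norm_nonneg _) ((abs_nonneg _).trans h3)
      · rw [norm_smul]
        refine le_trans ?_ h4
        gcongr
        exact PiLp.norm_apply_le (f x) j
  exact (Finset.sum_le_sum fun j _ => hb j).trans_eq (by simp)

end

def caccioppoliConst (n : ℕ) (K : ℝ) : ℝ :=
  2 * K * ((n * n.factorial) * (n * n.factorial / (1 / (2 * K))) ^ (n - 1))

theorem QROn.caccioppoli {n : ℕ} (hn : 2 ≤ n) {K : ℝ} (hK : 0 < K) {U : Set (Vec n)}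
    {f : Vec n → Vec n} (hf : QROn n K U f) {x₀ : Vec n} {R R' : ℝ} (hR : 0 < R) (hRR : R < R')
    (hRU : closedBall x₀ R' ⊆ U)
    (hi : IntegrableOn (fun x => ‖fderiv ℝ f x‖ ^ n) (closedBall x₀ R')) {φ : Vec n → ℝ}
    (hφ : ContDiff ℝ 1 φ) (hφ0 : ∀ x, 0 ≤ φ x) (hφs : tsupport φ ⊆ closedBall x₀ R) (i : Fin n)
    {v v' w : ℝ → ℝ} (hv : ∀ s, HasDerivAt v (v' s) s) (hv'c : Continuous v')
    (hv'0 : ∀ s, 0 ≤ v' s) (hvw : ∀ s, |v s| ≤ w s * v' s) (hwc : Continuous w)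
    (hw0 : ∀ s, 0 ≤ w s) :
    Integrable (fun x => φ x ^ n * v' (f x i) * ‖fderiv ℝ f x‖ ^ n) ∧
    Integrable (fun x => v' (f x i) * w (f x i) ^ n * ‖fderiv ℝ φ x‖ ^ n) ∧
    ∫ x, φ x ^ n * v' (f x i) * ‖fderiv ℝ f x‖ ^ n
      ≤ caccioppoliConst n K * ∫ x, v' (f x i) * w (f x i) ^ n * ‖fderiv ℝ φ x‖ ^ n := by
  have hn0 : n ≠ 0 := by omega
  let χb : ContDiffBump x₀ := ⟨(R + R') / 2, R', by linarith, by linarith⟩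
  let χ : Vec n → ℝ := χb
  have hχ : ContDiff ℝ 1 χ := χb.contDiff
  have hχs : tsupport χ = closedBall x₀ R' := χb.tsupport_eq
  have hBB : closedBall x₀ R ⊆ closedBall x₀ R' := closedBall_subset_closedBall hRR.le
  have hχ1 : ∀ x, φ x ≠ 0 → χ =ᶠ[𝓝 x] 1 := by
    intro x hx
    have hxR := hφs (subset_tsupport φ hx)
    rw [mem_closedBall] at hxR
    exact χb.eventuallyEq_one_of_mem_ball (by
      rw [mem_ball]; exact hxR.trans_lt (by change R < (R + R') / 2; linarith))
  have hφd : Differentiable ℝ φ := hφ.differentiable one_ne_zero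
  have hχd : Differentiable ℝ χ := hχ.differentiable one_ne_zero
  have hDφ0 : ∀ x, x ∉ closedBall x₀ R → fderiv ℝ φ x = 0 := fun x hx => by
    by_contra h
    exact hx (hφs (support_fderiv_subset ℝ h))
  have hφ00 : ∀ x, x ∉ closedBall x₀ R → φ x = 0 := fun x hx => by
    by_contra h
    exact hx (hφs (subset_tsupport _ h))
  set h := testMap φ χ f v i with hh
  have hzero : ∀ x, x ∉ closedBall x₀ R' → h x = 0 := fun x hx => by
    have h1 : φ x = 0 := hφ00 x fun h => hx (hBB h)
    have h2 : χ x = 0 := by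
      by_contra h
      exact hx (hχs ▸ subset_tsupport _ h)
    ext j
    simp [hh, testMap, h1, h2, hn0]
  have hts : tsupport h ⊆ closedBall x₀ R' :=
    closure_minimal (fun x hx => by by_contra h; exact hx (hzero x h)) isClosed_closedBall
  have hhc : HasCompactSupport h := (isCompact_closedBall x₀ R').of_isClosed_subset
    (isClosed_tsupport h) hts
  have hhd : Differentiable ℝ h := differentiable_of_tsupport fun x hx =>
    differentiableAt_testMap (hf.differentiableAt x (hRU (hts hx))) (hφd x) (hχd x) i hv
  have hDh0 : ∀ x, x ∉ closedBall x₀ R' → fderiv ℝ h x = 0 := fun x hx => by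
    by_contra h
    exact hx (hts (support_fderiv_subset ℝ h))
  have hfc : ContinuousOn f (closedBall x₀ R') := fun x hx =>
    (hf.differentiableAt x (hRU hx)).continuousAt.continuousWithinAt
  have hfic : ContinuousOn (fun x => f x i) (closedBall x₀ R') :=
    (EuclideanSpace.proj i : Vec n →L[ℝ] ℝ).continuous.comp_continuousOn hfc
  have hvc : Continuous v := continuous_iff_continuousAt.2 fun s => (hv s).continuousAt
  have hDφc : Continuous (fderiv ℝ φ) := hφ.continuous_fderiv one_ne_zero
  have hDχc : Continuous (fderiv ℝ χ) := hχ.continuous_fderiv one_ne_zero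
  have hvf := hvc.comp_continuousOn hfic
  have hv'f := hv'c.comp_continuousOn hfic
  have hwf := hwc.comp_continuousOn hfic
  simp only [Function.comp_def] at hvf hv'f hwf
  have hφc := hφ.continuous
  have hχc := hχ.continuous
  have hPc : ContinuousOn (fun x => φ x ^ n * v' (f x i)) (closedBall x₀ R') := by fun_prop
  obtain ⟨M, hM⟩ : ∃ M, ∀ x ∈ closedBall x₀ R',
      |n * φ x ^ (n - 1) * v (f x i)| * ‖fderiv ℝ φ x‖ ≤ M ∧ |φ x ^ n * v' (f x i)| ≤ M ∧
      |χ x| ≤ M ∧ ‖f x‖ * ‖fderiv ℝ χ x‖ ≤ M := by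
    have hc : ContinuousOn (fun x => |n * φ x ^ (n - 1) * v (f x i)| * ‖fderiv ℝ φ x‖
        + |φ x ^ n * v' (f x i)| + |χ x| + ‖f x‖ * ‖fderiv ℝ χ x‖) (closedBall x₀ R') := by
      fun_prop
    obtain ⟨M, hM⟩ := (isCompact_closedBall x₀ R').exists_bound_of_continuousOn hc
    refine ⟨M, fun x hx => ?_⟩
    have := (le_abs_self _).trans (hM x hx)
    have h1 : 0 ≤ |n * φ x ^ (n - 1) * v (f x i)| * ‖fderiv ℝ φ x‖ := by positivity
    have h2 : 0 ≤ |φ x ^ n * v' (f x i)| := abs_nonneg _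
    have h3 : 0 ≤ |χ x| := abs_nonneg _
    have h4 : 0 ≤ ‖f x‖ * ‖fderiv ℝ χ x‖ := by positivity
    exact ⟨by linarith, by linarith, by linarith, by linarith⟩
  have hM0 : 0 ≤ M := (abs_nonneg _).trans (hM x₀ (mem_closedBall_self (by linarith))).2.2.1
  have hbound : ∀ x ∈ closedBall x₀ R',
      ‖fderiv ℝ h x‖ ≤ n * (M * (1 + ‖fderiv ℝ f x‖)) := fun x hx =>
    norm_fderiv_testMap_le (hf.differentiableAt x (hRU hx)) (hφd x) (hχd x) i hv (hM x hx).1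
      (hM x hx).2.1 (hM x hx).2.2.1 (hM x hx).2.2.2
  have hDfm : Measurable fun x => ‖fderiv ℝ f x‖ := (measurable_fderiv ℝ f).norm
  have hDhm : Measurable (fderiv ℝ h) := measurable_fderiv ℝ h
  have hhi : Integrable fun x => ‖fderiv ℝ h x‖ ^ n := by
    have h1 : IntegrableOn (fun x => ‖fderiv ℝ h x‖ ^ n) (closedBall x₀ R') := by
      have h2 : IntegrableOn (fun x => (n * M) ^ n * (2 ^ (n - 1) * (1 + ‖fderiv ℝ f x‖ ^ n)))
          (closedBall x₀ R') :=
        (((integrableOn_const (isCompact_closedBall x₀ R').measure_lt_top.ne).add hi).const_mul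
          _).const_mul _
      refine Integrable.mono' h2 (hDhm.norm.pow_const n).aestronglyMeasurable ?_
      filter_upwards [ae_restrict_mem isClosed_closedBall.measurableSet] with x hx
      rw [norm_pow, norm_norm]
      calc ‖fderiv ℝ h x‖ ^ n ≤ (n * (M * (1 + ‖fderiv ℝ f x‖))) ^ n := by
            gcongr; exact hbound x hx
        _ = (n * M) ^ n * (1 + ‖fderiv ℝ f x‖) ^ n := by rw [← mul_assoc, mul_pow]
        _ ≤ _ := by
            gcongr
            simpa using add_pow_le (zero_le_one (α := ℝ)) (norm_nonneg (fderiv ℝ f x)) n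
    exact h1.integrable_of_forall_notMem_eq_zero fun x hx => by
      rw [hDh0 x hx, norm_zero, zero_pow hn0]
  have hdet : ∫ x, (fderiv ℝ h x).det = 0 := integral_det_fderiv_eq_zero (by omega) hhd hhc hhi
  have hdeti : Integrable fun x => (fderiv ℝ h x).det :=
    (hhi.const_mul (n.factorial : ℝ)).mono'
      (ContinuousLinearMap.continuous_det.measurable.comp hDhm).aestronglyMeasurable
      (Eventually.of_forall fun x => abs_det_le _)
  have hPi : Integrable (fun x => φ x ^ n * v' (f x i) * ‖fderiv ℝ f x‖ ^ n) := by
    have h1 : IntegrableOn (fun x => φ x ^ n * v' (f x i) * ‖fderiv ℝ f x‖ ^ n)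
        (closedBall x₀ R') :=
      hi.continuousOn_mul hPc (isCompact_closedBall x₀ R')
    exact h1.integrable_of_forall_notMem_eq_zero fun x hx => by
      rw [hφ00 x fun h => hx (hBB h), zero_pow hn0, zero_mul, zero_mul]
  have hQi : Integrable (fun x => v' (f x i) * w (f x i) ^ n * ‖fderiv ℝ φ x‖ ^ n) := by
    have h1 : ContinuousOn (fun x => v' (f x i) * w (f x i) ^ n * ‖fderiv ℝ φ x‖ ^ n)
        (closedBall x₀ R') := by fun_prop
    exact (h1.integrableOn_compact (isCompact_closedBall x₀ R')).integrable_of_forall_notMem_eq_zero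
      fun x hx => by rw [hDφ0 x fun h => hx (hBB h), norm_zero, zero_pow hn0, mul_zero]
  refine ⟨hPi, hQi, ?_⟩
  have hpt : ∀ᵐ x, φ x ^ n * v' (f x i) * ‖fderiv ℝ f x‖ ^ n
      ≤ 2 * K * (fderiv ℝ h x).det
        + caccioppoliConst n K * (v' (f x i) * w (f x i) ^ n * ‖fderiv ℝ φ x‖ ^ n) := by
    filter_upwards [hf.distortion] with x hx
    by_cases hxB : x ∈ closedBall x₀ R'
    · have hdx := hx (hRU hxB)
      have hform := det_fderiv_testMap hn (hf.differentiableAt x (hRU hxB)) (hφd x) (hχd x) i hv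
        (hχ1 x)
      rw [← hh] at hform
      set A := fderiv ℝ f x
      set D := fderiv ℝ φ x
      set T := rowDet (Function.update (rowOf A) i D)
      have hT : |T| ≤ n.factorial * (‖D‖ * ‖A‖ ^ (n - 1)) := abs_rowDet_update_le A i D
      have hφx := hφ0 x
      have hv'x := hv'0 (f x i)
      have hwx := hw0 (f x i)
      have hT2 : |n * φ x ^ (n - 1) * v (f x i) * T|
          ≤ v' (f x i) * ((n * n.factorial) * (φ x * ‖A‖) ^ (n - 1) * (w (f x i) * ‖D‖)) := by
        rw [abs_mul, abs_mul, abs_mul, abs_of_nonneg (pow_nonneg hφx _), Nat.abs_cast]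
        calc n * φ x ^ (n - 1) * |v (f x i)| * |T|
            ≤ n * φ x ^ (n - 1) * (w (f x i) * v' (f x i))
              * (n.factorial * (‖D‖ * ‖A‖ ^ (n - 1))) := by
              gcongr; exact hvw _
          _ = _ := by rw [mul_pow]; ring
      have hY := mul_pow_pred_mul_le (n := n) (by omega) (C := n * n.factorial)
        (ε := 1 / (2 * K)) (a := φ x * ‖A‖) (b := w (f x i) * ‖D‖) (by positivity)
        (by positivity) (by positivity) (by positivity)
      have hY2 := mul_le_mul_of_nonneg_left hY hv'x
      have hmain : φ x ^ n * v' (f x i) * ‖A‖ ^ n ≤ φ x ^ n * v' (f x i) * (K * A.det) := by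
        gcongr
      have h5 := neg_abs_le (n * φ x ^ (n - 1) * v (f x i) * T)
      have h6 : φ x ^ n * v' (f x i) * A.det ≤ (fderiv ℝ h x).det
          + v' (f x i) * (1 / (2 * K) * (φ x * ‖A‖) ^ n + (n * n.factorial) *
            ((n * n.factorial) / (1 / (2 * K))) ^ (n - 1) * (w (f x i) * ‖D‖) ^ n) := by
        linarith
      have h7 := mul_le_mul_of_nonneg_left h6 hK.le
      have h8 : K * (v' (f x i) * (1 / (2 * K) * (φ x * ‖A‖) ^ n))
          = φ x ^ n * v' (f x i) * ‖A‖ ^ n / 2 := by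
        rw [mul_pow]; field_simp
      have h9 : caccioppoliConst n K * (v' (f x i) * w (f x i) ^ n * ‖D‖ ^ n)
          = 2 * (K * (v' (f x i) * ((n * n.factorial) *
            ((n * n.factorial) / (1 / (2 * K))) ^ (n - 1) * (w (f x i) * ‖D‖) ^ n))) := by
        rw [caccioppoliConst, mul_pow]; ring
      rw [h9]
      linarith
    · rw [hφ00 x fun h => hxB (hBB h), zero_pow hn0, zero_mul, zero_mul, hDh0 x hxB,
        hDφ0 x fun h => hxB (hBB h), norm_zero, zero_pow hn0, mul_zero, mul_zero, add_zero]
      have : Nonempty (Fin n) := ⟨i⟩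
      have h0 : (0 : Vec n →L[ℝ] Vec n).det = 0 := LinearMap.det_zero'' (M := Vec n)
      rw [h0, mul_zero]
  have := integral_mono_ae hPi ((hdeti.const_mul (2 * K)).add
    (hQi.const_mul (caccioppoliConst n K))) hpt
  refine this.trans_eq ?_
  simp only [Pi.add_apply]
  rw [integral_add (hdeti.const_mul _) (hQi.const_mul _), integral_const_mul, integral_const_mul,
    hdet, mul_zero, zero_add]

theorem exists_abs_deriv_smoothTransition_le :
    ∃ M : ℝ, 0 < M ∧ ∀ s, |deriv Real.smoothTransition s| ≤ M := by
  have hc : Continuous (deriv Real.smoothTransition) :=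
    (Real.smoothTransition.contDiff (n := 1)).continuous_deriv (by simp)
  obtain ⟨M, hM⟩ := (isCompact_Icc (a := (0 : ℝ)) (b := 1)).exists_bound_of_continuousOn
    hc.continuousOn
  refine ⟨max M 1, by positivity, fun s => ?_⟩
  rcases lt_or_ge s 0 with h | h
  · have : Real.smoothTransition =ᶠ[𝓝 s] fun _ => 0 := by
      filter_upwards [Iio_mem_nhds h] with t ht
      exact Real.smoothTransition.zero_of_nonpos (le_of_lt ht)
    rw [this.deriv_eq, deriv_const, abs_zero]
    positivity
  rcases lt_or_ge 1 s with h1 | h1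
  · have : Real.smoothTransition =ᶠ[𝓝 s] fun _ => 1 := by
      filter_upwards [Ioi_mem_nhds h1] with t ht
      exact Real.smoothTransition.one_of_one_le (le_of_lt ht)
    rw [this.deriv_eq, deriv_const, abs_zero]
    positivity
  · exact (hM s ⟨h, h1⟩).trans (le_max_left _ _)

/-- Smooth cutoffs between concentric balls, with a gradient bound uniform in the radii. -/
theorem exists_cutoff : ∃ C : ℝ, 0 < C ∧ ∀ {n : ℕ} (x₀ : Vec n) {r R : ℝ}, 0 < r → r < R →
    ∃ φ : Vec n → ℝ, ContDiff ℝ 1 φ ∧ (∀ x, 0 ≤ φ x) ∧ (∀ x, φ x ≤ 1) ∧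
      (∀ x ∈ closedBall x₀ r, φ x = 1) ∧ tsupport φ ⊆ closedBall x₀ R ∧
      ∀ x, ‖fderiv ℝ φ x‖ ≤ C / (R - r) := by
  obtain ⟨M, hM0, hM⟩ := exists_abs_deriv_smoothTransition_le
  refine ⟨2 * M, by positivity, fun {n} x₀ {r R} hr hrR => ?_⟩
  have hpos : 0 < R ^ 2 - r ^ 2 := by nlinarith
  let g : Vec n → ℝ := fun x => (R ^ 2 - ‖x - x₀‖ ^ 2) / (R ^ 2 - r ^ 2)
  let φ : Vec n → ℝ := fun x => Real.smoothTransition (g x)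
  have hts : tsupport φ ⊆ closedBall x₀ R := by
    refine closure_minimal (fun x hx => ?_) isClosed_closedBall
    by_contra h
    refine hx (Real.smoothTransition.zero_of_nonpos ?_)
    rw [mem_closedBall, dist_eq_norm, not_le] at h
    exact div_nonpos_of_nonpos_of_nonneg (by nlinarith) hpos.le
  refine ⟨φ, ?_, fun x => Real.smoothTransition.nonneg _,
    fun x => Real.smoothTransition.le_one _, fun x hx => ?_, hts, fun x => ?_⟩
  · refine (Real.smoothTransition.contDiff (n := 1)).comp ?_
    exact (contDiff_const.sub ((contDiff_id.sub contDiff_const).norm_sq ℝ)).div_const _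
  · rw [mem_closedBall, dist_eq_norm] at hx
    refine Real.smoothTransition.one_of_one_le ?_
    rw [le_div_iff₀ hpos]
    nlinarith [norm_nonneg (x - x₀)]
  · by_cases hx : x ∈ closedBall x₀ R
    · rw [mem_closedBall, dist_eq_norm] at hx
      have h1 : HasFDerivAt (fun y : Vec n => ‖y - x₀‖ ^ 2)
          (2 • (innerSL ℝ (x - x₀)).comp (ContinuousLinearMap.id ℝ (Vec n))) x :=
        ((hasFDerivAt_id x).sub_const x₀).norm_sq
      have h2 : HasFDerivAt g ((R ^ 2 - r ^ 2)⁻¹ • -(2 • (innerSL ℝ (x - x₀)).comp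
          (ContinuousLinearMap.id ℝ (Vec n)) : Vec n →L[ℝ] ℝ)) x := by
        refine ((h1.const_sub (R ^ 2)).const_mul (R ^ 2 - r ^ 2)⁻¹).congr_of_eventuallyEq ?_
        exact Eventually.of_forall fun y => by simp only [g]; rw [div_eq_inv_mul]
      have h3 : HasDerivAt Real.smoothTransition (deriv Real.smoothTransition (g x)) (g x) :=
        ((Real.smoothTransition.contDiff (n := 1)).differentiable (by simp) _).hasDerivAt
      have h4 : HasFDerivAt φ _ x := h3.comp_hasFDerivAt x h2
      rw [h4.fderiv, norm_smul, norm_smul, norm_neg, ContinuousLinearMap.comp_id,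
        ← Nat.cast_smul_eq_nsmul ℝ, norm_smul,
        innerSL_apply_norm, Real.norm_eq_abs, Real.norm_of_nonneg (inv_nonneg.2 hpos.le)]
      calc |deriv Real.smoothTransition (g x)| * ((R ^ 2 - r ^ 2)⁻¹ * (‖((2 : ℕ) : ℝ)‖ * ‖x - x₀‖))
          ≤ M * ((R ^ 2 - r ^ 2)⁻¹ * (2 * (R + r))) := by
            gcongr
            · exact hM _
            · simp
            · linarith
        _ = 2 * M / (R - r) := by
            have : R - r ≠ 0 := by linarith
            have : R + r ≠ 0 := by linarith
            rw [show R ^ 2 - r ^ 2 = (R - r) * (R + r) by ring]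
            field_simp
    · have : fderiv ℝ φ x = 0 := by
        by_contra h
        exact hx (hts (support_fderiv_subset ℝ h))
      rw [this, norm_zero]
      exact div_nonneg (by positivity) (by linarith)

theorem volume_closedBall_mul {n : ℕ} (x : Vec n) {c r : ℝ} (hc : 0 ≤ c) (hr : 0 ≤ r) :
    volume (closedBall x (c * r)) = ENNReal.ofReal (c ^ n) * volume (closedBall x r) := by
  rw [Measure.addHaar_closedBall_mul _ _ hc hr, finrank_euclideanSpace_fin,
    Measure.addHaar_closedBall_center _ x]

/-- If `f` oscillates by at most `L * d` on a ball of radius `d`, then its energy on a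
quarter of that ball is controlled by the volume. -/
theorem exists_energy_le {n : ℕ} (hn : 2 ≤ n) {K : ℝ} (hK : 0 < K) :
    ∃ C : ℝ, 0 ≤ C ∧ ∀ {U : Set (Vec n)} {f : Vec n → Vec n}, QROn n K U f →
      ∀ {x₀ a : Vec n} {d L : ℝ}, 0 < d → 0 ≤ L → closedBall x₀ (3 / 4 * d) ⊆ U →
      IntegrableOn (fun x => ‖fderiv ℝ f x‖ ^ n) (closedBall x₀ (3 / 4 * d)) →
      (∀ x ∈ closedBall x₀ (3 / 4 * d), ‖f x - a‖ ≤ L * d) →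
      ∫⁻ x in closedBall x₀ (5 * (d / 20)), ENNReal.ofReal (‖fderiv ℝ f x‖ ^ n)
        ≤ ENNReal.ofReal (C * L ^ n) * volume (closedBall x₀ (d / 20)) := by
  obtain ⟨C₀, hC₀, hcut⟩ := exists_cutoff
  have hcK : 0 ≤ caccioppoliConst n K := by rw [caccioppoliConst]; positivity
  refine ⟨caccioppoliConst n K * (C₀ * 4) ^ n * 10 ^ n, by positivity, ?_⟩
  intro U f hf x₀ a d L hd hL hU hi ha
  have hn0 : n ≠ 0 := by omega
  obtain ⟨φ, hφ, hφ0, hφ1, hφr, hφs, hφD⟩ := hcut x₀ (r := d / 4) (R := d / 2) (by linarith)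
    (by linarith)
  let i : Fin n := ⟨0, by omega⟩
  obtain ⟨h1, h2, h3⟩ := hf.caccioppoli hn hK (R := d / 2) (by linarith) (by linarith) hU hi hφ hφ0
    hφs i (v := fun s => s - a i) (v' := fun _ => 1) (w := fun s => |s - a i|)
    (fun s => (hasDerivAt_id s).sub_const _) continuous_const (fun _ => zero_le_one)
    (fun s => by simp) (by fun_prop) (fun s => abs_nonneg _)
  simp only [mul_one, one_mul] at h1 h2 h3
  have hb : ∀ x, |f x i - a i| ^ n * ‖fderiv ℝ φ x‖ ^ n
      ≤ (closedBall x₀ (d / 2)).indicator (fun _ => (C₀ * 4) ^ n * L ^ n) x := fun x => by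
    by_cases hx : x ∈ closedBall x₀ (d / 2)
    · rw [indicator_of_mem hx, ← mul_pow, ← mul_pow]
      refine pow_le_pow_left₀ (by positivity) ?_ n
      have h5 : |f x i - a i| ≤ L * d := by
        refine le_trans ?_ (ha x (closedBall_subset_closedBall (by linarith) hx))
        simpa using PiLp.norm_apply_le (f x - a) i
      calc |f x i - a i| * ‖fderiv ℝ φ x‖ ≤ (L * d) * (C₀ / (d / 2 - d / 4)) := by
            gcongr
            exact hφD x
        _ = C₀ * 4 * L := by field_simp; ring
    · have : fderiv ℝ φ x = 0 := by
        by_contra h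
        exact hx (hφs (support_fderiv_subset ℝ h))
      rw [indicator_of_notMem hx, this, norm_zero, zero_pow hn0, mul_zero]
  have hind : Integrable ((closedBall x₀ (d / 2)).indicator fun _ : Vec n => (C₀ * 4) ^ n * L ^ n) :=
    (integrable_indicator_iff isClosed_closedBall.measurableSet).2
      (integrableOn_const (isCompact_closedBall _ _).measure_lt_top.ne)
  have h4 := integral_mono h2 hind hb
  rw [integral_indicator isClosed_closedBall.measurableSet, setIntegral_const, smul_eq_mul] at h4
  rw [show 5 * (d / 20) = d / 4 by ring]
  calc ∫⁻ x in closedBall x₀ (d / 4), ENNReal.ofReal (‖fderiv ℝ f x‖ ^ n)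
      = ∫⁻ x in closedBall x₀ (d / 4), ENNReal.ofReal (φ x ^ n * ‖fderiv ℝ f x‖ ^ n) := by
        refine setLIntegral_congr_fun isClosed_closedBall.measurableSet fun x hx => ?_
        simp only [hφr x hx, one_pow, one_mul]
    _ ≤ ∫⁻ x, ENNReal.ofReal (φ x ^ n * ‖fderiv ℝ f x‖ ^ n) := setLIntegral_le_lintegral _ _
    _ = ENNReal.ofReal (∫ x, φ x ^ n * ‖fderiv ℝ f x‖ ^ n) :=
        (ofReal_integral_eq_lintegral_ofReal h1 (Eventually.of_forall fun x => by
          have := hφ0 x; positivity)).symm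
    _ ≤ ENNReal.ofReal (caccioppoliConst n K * (volume.real (closedBall x₀ (d / 2))
          * ((C₀ * 4) ^ n * L ^ n))) :=
        ENNReal.ofReal_le_ofReal (h3.trans (by gcongr))
    _ = ENNReal.ofReal (caccioppoliConst n K * (C₀ * 4) ^ n * L ^ n)
          * volume (closedBall x₀ (d / 2)) := by
        rw [show caccioppoliConst n K * (volume.real (closedBall x₀ (d / 2))
          * ((C₀ * 4) ^ n * L ^ n)) = (caccioppoliConst n K * (C₀ * 4) ^ n * L ^ n)
            * volume.real (closedBall x₀ (d / 2)) by ring, ENNReal.ofReal_mul (by positivity),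
          Measure.real, ENNReal.ofReal_toReal (isCompact_closedBall _ _).measure_lt_top.ne]
    _ = _ := by
        rw [show d / 2 = 10 * (d / 20) by ring, volume_closedBall_mul _ (by norm_num)
          (by positivity), ← mul_assoc, ← ENNReal.ofReal_mul (by positivity)]
        congr 2
        ring

/-- A Baire category argument: a differentiable function is uniformly pointwise Lipschitz at the
points of some nonempty relatively open piece of a relatively closed set. -/
theorem exists_pointwise_lipschitz {n : ℕ} {U F : Set (Vec n)} {f : Vec n → Vec n} (hU : IsOpen U)
    (hF : IsLocallyClosed F) (hFU : F ⊆ U) (hne : F.Nonempty)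
    (hd : ∀ x ∈ U, DifferentiableAt ℝ f x) :
    ∃ y₀ ∈ F, ∃ κ ε : ℝ, 0 < κ ∧ 0 < ε ∧ ε < κ⁻¹ ∧ ball y₀ ε ⊆ U ∧
      ∀ y ∈ F, dist y y₀ < ε → ∀ x ∈ U, dist x y < κ⁻¹ → ‖f x - f y‖ ≤ κ * ‖x - y‖ := by
  have := hF.locallyCompactSpace
  have := hne.to_subtype
  have hfc : ContinuousOn f U := fun x hx => (hd x hx).continuousAt.continuousWithinAt
  let E : ℕ → Set F := fun k => {y | ∀ x ∈ U, dist x (y : Vec n) < ((k : ℝ) + 1)⁻¹ →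
    ‖f x - f y‖ ≤ ((k : ℝ) + 1) * ‖x - y‖}
  have hEc : ∀ k, IsClosed (E k) := fun k => by
    have : E k = ⋂ x ∈ U, ({y : F | ((k : ℝ) + 1)⁻¹ ≤ dist x (y : Vec n)} ∪
        {y : F | ‖f x - f y‖ ≤ ((k : ℝ) + 1) * ‖x - y‖}) := by
      ext y
      simp only [E, mem_ofPred_eq, mem_iInter, mem_union]
      refine forall₂_congr fun x hx => ?_
      rw [imp_iff_not_or, not_lt]
    rw [this]
    have hfF : Continuous fun y : F => f y :=
      (hfc.mono hFU).domRestrict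
    refine isClosed_biInter fun x _ => IsClosed.union ?_ ?_
    · exact isClosed_le continuous_const (by fun_prop)
    · exact isClosed_le (continuous_const.sub hfF).norm (by fun_prop)
  have hEu : ⋃ k, E k = univ := by
    refine eq_univ_of_forall fun y => mem_iUnion.2 ?_
    obtain ⟨C, hC⟩ := (hd y (hFU y.2)).isBigO_sub.bound
    obtain ⟨δ, hδ, hball⟩ := Metric.eventually_nhds_iff.1 hC
    obtain ⟨k, hk⟩ := exists_nat_gt (max C δ⁻¹)
    refine ⟨k, fun x _ hxy => ?_⟩
    have hk1 : δ⁻¹ < (k : ℝ) + 1 := by linarith [le_max_right C δ⁻¹]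
    refine (hball (hxy.trans ((inv_lt_comm₀ hδ (by positivity)).1 hk1))).trans ?_
    gcongr
    linarith [le_max_left C δ⁻¹]
  obtain ⟨k, y₀, hy₀⟩ := nonempty_interior_of_iUnion_of_closed hEc hEu
  obtain ⟨ε₁, hε₁, hb₁⟩ := Metric.mem_nhds_iff.1 (mem_interior_iff_mem_nhds.1 hy₀)
  obtain ⟨ε₂, hε₂, hb₂⟩ := Metric.isOpen_iff.1 hU y₀ (hFU y₀.2)
  have hk : (0 : ℝ) < ((k : ℝ) + 1)⁻¹ := by positivity
  have hε : 0 < min (min ε₁ ε₂) (((k : ℝ) + 1)⁻¹ / 2) := by positivity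
  refine ⟨y₀, y₀.2, (k : ℝ) + 1, min (min ε₁ ε₂) (((k : ℝ) + 1)⁻¹ / 2), by positivity, hε,
    (min_le_right _ _).trans_lt (by linarith),
    (ball_subset_ball ((min_le_left _ _).trans (min_le_right _ _))).trans hb₂, ?_⟩
  intro y hy hyy
  have : (⟨y, hy⟩ : F) ∈ E k :=
    hb₁ (mem_ball.2 (hyy.trans_le ((min_le_left _ _).trans (min_le_left _ _))))
  exact this

/-- Local integrability of `|Df|ⁿ` for everywhere differentiable maps of bounded distortion. -/
theorem QROn.locallyIntegrableOn {n : ℕ} (hn : 2 ≤ n) {K : ℝ} (hK : 0 < K) {U : Set (Vec n)}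
    {f : Vec n → Vec n} (hf : QROn n K U f) :
    LocallyIntegrableOn (fun x => ‖fderiv ℝ f x‖ ^ n) U := by
  have hDm : Measurable fun x => ‖fderiv ℝ f x‖ ^ n := (measurable_fderiv ℝ f).norm.pow_const n
  set e : Vec n → ℝ≥0∞ := fun x => ENNReal.ofReal (‖fderiv ℝ f x‖ ^ n) with he
  have hinteg : ∀ s : Set (Vec n), ∫⁻ x in s, e x < ⊤ → IntegrableOn (fun x => ‖fderiv ℝ f x‖ ^ n) s :=
    fun s hs => ⟨hDm.aestronglyMeasurable, by
      rw [hasFiniteIntegral_iff_ofReal (Eventually.of_forall fun x => by positivity)]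
      exact hs⟩
  let G : Set (Vec n) := {x | ∃ r > 0, ∫⁻ y in ball x r, e y < ⊤}
  have hGo : IsOpen G := by
    refine Metric.isOpen_iff.2 fun x ⟨r, hr, hx⟩ => ⟨r, hr, fun y hy => ?_⟩
    rw [mem_ball] at hy
    refine ⟨r - dist y x, by linarith, lt_of_le_of_lt (lintegral_mono_set ?_) hx⟩
    exact ball_subset_ball' (by linarith)
  have hGi : LocallyIntegrableOn (fun x => ‖fderiv ℝ f x‖ ^ n) G := fun x ⟨r, hr, hx⟩ =>
    ⟨ball x r, mem_nhdsWithin_of_mem_nhds (ball_mem_nhds x hr), hinteg _ hx⟩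
  suffices hUG : U ⊆ G from hGi.mono_set hUG
  by_contra hcon
  obtain ⟨z, hzU, hzG⟩ := not_subset.1 hcon
  set F := U ∩ Gᶜ with hF
  obtain ⟨y₀, hy₀, κ, ε, hκ, hε, hεκ, hεU, hlip⟩ := exists_pointwise_lipschitz (F := F) hf.isOpen
    (hf.isOpen.isLocallyClosed.inter hGo.isClosed_compl.isLocallyClosed) inter_subset_left
    ⟨z, hzU, hzG⟩ hf.differentiableAt
  refine hy₀.2 ⟨ε / 4, by linarith, ?_⟩
  have hFm : MeasurableSet F := hf.isOpen.measurableSet.inter hGo.measurableSet.compl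
  have hsplit : ball y₀ (ε / 4) ⊆ (F ∩ ball y₀ (ε / 4)) ∪ (G ∩ ball y₀ (ε / 4)) := fun x hx => by
    by_cases hxG : x ∈ G
    · exact Or.inr ⟨hxG, hx⟩
    · exact Or.inl ⟨⟨hεU (ball_subset_ball (by linarith) hx), hxG⟩, hx⟩
  refine ((lintegral_mono_set hsplit).trans (lintegral_union_le _ _ _)).trans_lt
    (ENNReal.add_lt_top.2 ⟨?_, ?_⟩)
  · have hle : ∀ x ∈ F ∩ ball y₀ (ε / 4), e x ≤ ENNReal.ofReal (κ ^ n) := fun x hx => by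
      refine ENNReal.ofReal_le_ofReal (pow_le_pow_left₀ (norm_nonneg _) ?_ n)
      refine (hf.differentiableAt x hx.1.1).hasFDerivAt.le_of_lip' hκ.le ?_
      filter_upwards [hf.isOpen.mem_nhds hx.1.1, ball_mem_nhds x (inv_pos.2 hκ)] with y hyU hyx
      exact hlip x hx.1 ((mem_ball.1 hx.2).trans (by linarith)) y hyU hyx
    calc ∫⁻ x in F ∩ ball y₀ (ε / 4), e x
        ≤ ∫⁻ x in F ∩ ball y₀ (ε / 4), ENNReal.ofReal (κ ^ n) :=
          setLIntegral_mono' (hFm.inter measurableSet_ball) hle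
      _ = ENNReal.ofReal (κ ^ n) * volume (F ∩ ball y₀ (ε / 4)) := by
          rw [setLIntegral_const]
      _ < ⊤ := ENNReal.mul_lt_top ENNReal.ofReal_lt_top
          ((measure_mono inter_subset_right).trans_lt measure_ball_lt_top)
  · obtain ⟨C, hC, henergy⟩ := exists_energy_le hn hK
    set W := G ∩ ball y₀ (ε / 4) with hW
    have hFne : F.Nonempty := ⟨y₀, hy₀⟩
    let d : Vec n → ℝ := fun x => infDist x F
    have hdpos : ∀ x ∈ W, 0 < d x := fun x hx => by
      obtain ⟨r, hr, hball⟩ := Metric.isOpen_iff.1 hGo x hx.1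
      refine hr.trans_le ((le_infDist hFne).2 fun y hy => ?_)
      by_contra h
      exact hy.2 (hball (by rw [mem_ball, dist_comm]; linarith))
    have hdε : ∀ x ∈ W, d x < ε / 4 := fun x hx => (infDist_le_dist_of_mem hy₀).trans_lt hx.2
    have hfar : ∀ x ∈ W, ball x (d x) ⊆ ball y₀ (ε / 2) := fun x hx => by
      refine ball_subset_ball' ?_
      linarith [hdε x hx, mem_ball.1 hx.2]
    have hball : ∀ x ∈ W, closedBall x (3 / 4 * d x) ⊆ U ∩ G := fun x hx y hy => by
      have hy1 : y ∈ ball x (d x) :=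
        closedBall_subset_ball (by linarith [hdpos x hx]) hy
      have hyU : y ∈ U := hεU (ball_subset_ball (by linarith) (hfar x hx hy1))
      refine ⟨hyU, ?_⟩
      by_contra h
      have hlt : dist x y < infDist x F := by rw [dist_comm]; exact mem_ball.1 hy1
      exact notMem_of_dist_lt_infDist hlt ⟨hyU, h⟩
    have hen : ∀ x ∈ W, ∫⁻ y in closedBall x (5 * (d x / 20)), e y
        ≤ ENNReal.ofReal (C * (3 * κ) ^ n) * volume (closedBall x (d x / 20)) := fun x hx => by
      have hdx := hdpos x hx
      have hdx2 := hdε x hx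
      obtain ⟨y, hyF, hxy⟩ := (infDist_lt_iff hFne).1 (show infDist x F < 2 * d x by
        change d x < 2 * d x; linarith)
      have hx2 := mem_ball.1 hx.2
      refine henergy hf (a := f y) hdx (by positivity) (fun z hz => (hball x hx hz).1)
        (hGi.integrableOn_compact_subset (fun z hz => (hball x hx hz).2)
          (isCompact_closedBall _ _)) fun z hz => ?_
      have hzx := mem_closedBall.1 hz
      have hzy : dist z y ≤ 3 * d x := by linarith [dist_triangle z x y]
      refine (hlip y hyF ?_ z (hball x hx hz).1 (by linarith)).trans ?_
      · linarith [dist_triangle y x y₀, dist_comm x y]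
      · rw [← dist_eq_norm]
        nlinarith
    obtain ⟨u, huW, hdisj, hcov⟩ := Vitali.exists_disjoint_subfamily_covering_enlargement_closedBall
      W id (fun x => d x / 20) (ε / 80) (fun x hx => by linarith [hdε x hx]) 5 (by norm_num)
    simp only [id] at hdisj hcov
    have hinterior : ∀ x ∈ u, (interior (closedBall x (d x / 20))).Nonempty := fun x hx =>
      ⟨x, mem_interior_iff_mem_nhds.2
        (closedBall_mem_nhds x (by linarith [hdpos x (huW hx)]))⟩
    have hucount : u.Countable := hdisj.countable_of_nonempty_interior hinterior
    have := hucount.to_subtype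
    have hWsub : W ⊆ ⋃ x : u, closedBall (x : Vec n) (5 * (d x / 20)) := fun x hx => by
      obtain ⟨b, hb, hsub⟩ := hcov x hx
      exact mem_iUnion.2 ⟨⟨b, hb⟩, hsub (mem_closedBall_self (by linarith [hdpos x hx]))⟩
    calc ∫⁻ x in W, e x ≤ ∫⁻ x in ⋃ x : u, closedBall (x : Vec n) (5 * (d x / 20)), e x :=
          lintegral_mono_set hWsub
      _ ≤ ∑' x : u, ∫⁻ y in closedBall (x : Vec n) (5 * (d x / 20)), e y :=
          lintegral_iUnion_le _ _
      _ ≤ ∑' x : u, ENNReal.ofReal (C * (3 * κ) ^ n) * volume (closedBall (x : Vec n) (d x / 20)) :=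
          ENNReal.tsum_le_tsum fun x => hen x (huW x.2)
      _ = ENNReal.ofReal (C * (3 * κ) ^ n) * volume (⋃ x ∈ u, closedBall x (d x / 20)) := by
          rw [ENNReal.tsum_mul_left, measure_biUnion hucount hdisj
            fun x _ => isClosed_closedBall.measurableSet]
      _ ≤ ENNReal.ofReal (C * (3 * κ) ^ n) * volume (ball y₀ (ε / 2)) := by
          gcongr
          refine iUnion₂_subset fun x hx => ?_
          exact (closedBall_subset_ball (by linarith [hdpos x (huW hx)])).trans (hfar x (huW hx))
      _ < ⊤ := ENNReal.mul_lt_top ENNReal.ofReal_lt_top measure_ball_lt_top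

theorem enorm_le_lintegral_deriv {g : ℝ → ℝ} (hd : Differentiable ℝ g) (hc : HasCompactSupport g)
    (t : ℝ) : ‖g t‖ₑ ≤ ∫⁻ s, ‖deriv g s‖ₑ := by
  by_cases hfin : ∫⁻ s, ‖deriv g s‖ₑ = ⊤
  · rw [hfin]; exact le_top
  have hi : Integrable (deriv g) :=
    ⟨(measurable_deriv g).aestronglyMeasurable, lt_top_iff_ne_top.2 hfin⟩
  have h := integral_Iic_of_hasDerivAt_of_tendsto' (a := t) (m := 0)
    (fun s _ => (hd s).hasDerivAt) hi.integrableOn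
    ((hc.is_zero_at_infty).mono_left atBot_le_cocompact)
  rw [sub_zero] at h
  rw [← h]
  exact (enorm_integral_le_lintegral_enorm _).trans (setLIntegral_le_lintegral _ _)

/-- The Gagliardo-Nirenberg-Sobolev inequality for `p = 1`, for functions which are only assumed to
be differentiable. -/
theorem lintegral_pow_le_pow_lintegral_fderiv_of_differentiable {ι : Type*} [Fintype ι]
    {p : ℝ} (hp : Real.HolderConjugate (Fintype.card ι) p) {u : (ι → ℝ) → ℝ}
    (hu : Differentiable ℝ u) (h2u : HasCompactSupport u) :
    ∫⁻ x, ‖u x‖ₑ ^ p ≤ (∫⁻ x, ‖fderiv ℝ u x‖ₑ) ^ p := by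
  have : (1 : ℝ) ≤ ↑(Fintype.card ι) - 1 := by
    have hι : (2 : ℝ) ≤ Fintype.card ι := by exact_mod_cast hp.lt
    linarith
  calc ∫⁻ x, ‖u x‖ₑ ^ p
      = ∫⁻ x, (‖u x‖ₑ ^ (1 / (Fintype.card ι - 1 : ℝ))) ^ (Fintype.card ι : ℝ) := by
        congr! 2 with x
        rw [← ENNReal.rpow_mul, hp.conjugate_eq]
        field_simp
    _ = ∫⁻ x, ∏ _i : ι, ‖u x‖ₑ ^ (1 / (Fintype.card ι - 1 : ℝ)) := by
        congr! 2 with x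
        simp_rw [Finset.prod_const]
        norm_cast
    _ ≤ ∫⁻ x, ∏ i, (∫⁻ xᵢ, ‖fderiv ℝ u (Function.update x i xᵢ)‖ₑ)
          ^ ((1 : ℝ) / (Fintype.card ι - 1 : ℝ)) := ?_
    _ ≤ (∫⁻ x, ‖fderiv ℝ u x‖ₑ) ^ p := by
        apply lintegral_prod_lintegral_pow_le _ hp
        exact (measurable_fderiv ℝ u).enorm
  gcongr with x i
  have hcomp : Differentiable ℝ (u ∘ Function.update x i) :=
    hu.comp fun y => (hasDerivAt_update x i y).differentiableAt
  calc ‖u x‖ₑ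
    _ ≤ ∫⁻ xᵢ, ‖deriv (u ∘ Function.update x i) xᵢ‖ₑ :=
        le_trans (by simp) (enorm_le_lintegral_deriv hcomp
          (h2u.comp_isClosedEmbedding (isClosedEmbedding_update x i)) (x i))
    _ ≤ ∫⁻ xᵢ, ‖fderiv ℝ u (Function.update x i xᵢ)‖ₑ := ?_
  gcongr with y
  calc ‖deriv (u ∘ Function.update x i) y‖ₑ
        = ‖fderiv ℝ u (Function.update x i y) (deriv (Function.update x i) y)‖ₑ := by
        rw [fderiv_comp_deriv _ hu.differentiableAt (hasDerivAt_update x i y).differentiableAt]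
    _ ≤ ‖fderiv ℝ u (Function.update x i y)‖ₑ * ‖deriv (Function.update x i) y‖ₑ :=
        ContinuousLinearMap.le_opENorm _ _
    _ ≤ ‖fderiv ℝ u (Function.update x i y)‖ₑ := by simp [deriv_update, Pi.enorm_single]

theorem exists_sobolev_const {n : ℕ} (hn : 2 ≤ n) : ∃ C : ℝ, 0 < C ∧ ∀ {u : Vec n → ℝ},
    Differentiable ℝ u → HasCompactSupport u →
    ∫⁻ x, ENNReal.ofReal (|u x| ^ ((n : ℝ) / (n - 1)))
      ≤ (ENNReal.ofReal C * ∫⁻ x, ENNReal.ofReal ‖fderiv ℝ u x‖) ^ ((n : ℝ) / (n - 1)) := by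
  let L : (Fin n → ℝ) ≃L[ℝ] Vec n := (EuclideanSpace.equiv (Fin n) ℝ).symm
  have hn' : (2 : ℝ) ≤ n := by exact_mod_cast hn
  have hp : Real.HolderConjugate (Fintype.card (Fin n)) ((n : ℝ) / (n - 1)) := by
    rw [Fintype.card_fin]
    exact Real.HolderConjugate.conjExponent (by linarith)
  refine ⟨‖(L : (Fin n → ℝ) →L[ℝ] Vec n)‖ + 1, by positivity, fun {u} hu hc => ?_⟩
  have hL : MeasurePreserving L := PiLp.volume_preserving_toLp (Fin n)
  have hLe : MeasurableEmbedding L := L.toHomeomorph.measurableEmbedding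
  have h1 := lintegral_pow_le_pow_lintegral_fderiv_of_differentiable hp (u := u ∘ L)
    (hu.comp L.differentiable) (hc.comp_homeomorph L.toHomeomorph)
  rw [← hL.lintegral_comp_emb hLe, ← hL.lintegral_comp_emb hLe]
  refine le_trans (le_of_eq ?_) (h1.trans ?_)
  · refine lintegral_congr fun x => ?_
    rw [← ENNReal.ofReal_rpow_of_nonneg (abs_nonneg _) (div_nonneg (by linarith) (by linarith)),
      ← Real.norm_eq_abs, ofReal_norm, Function.comp_apply]
  · refine ENNReal.rpow_le_rpow ?_ (div_nonneg (by linarith) (by linarith))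
    rw [← lintegral_const_mul' _ _ ENNReal.ofReal_ne_top]
    refine lintegral_mono fun x => ?_
    have : fderiv ℝ (u ∘ L) x = (fderiv ℝ u (L x)).comp (L : (Fin n → ℝ) →L[ℝ] Vec n) := by
      rw [fderiv_comp _ (hu _) L.differentiableAt, L.fderiv]
    rw [this, ← ofReal_norm, ← ENNReal.ofReal_mul (by positivity)]
    refine ENNReal.ofReal_le_ofReal ((ContinuousLinearMap.opNorm_comp_le _ _).trans ?_)
    rw [mul_comm]
    gcongr
    linarith

theorem abs_rpow_sub_mul_pow {q : ℝ} {k : ℕ} (hk : (k : ℝ) < q) (s : ℝ) :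
    |s| ^ (q - k) * |s| ^ k = |s| ^ q := by
  rw [← Real.rpow_natCast, ← Real.rpow_add_of_nonneg (abs_nonneg s) (by linarith) (by positivity)]
  congr 1; ring

theorem hasDerivAt_abs_rpow_mul_self {m : ℝ} (hm : 2 < m) (s : ℝ) :
    HasDerivAt (fun t : ℝ => |t| ^ m * t) ((m + 1) * |s| ^ m) s := by
  refine ((hasDerivAt_abs_rpow s (by linarith : 1 < m)).mul (hasDerivAt_id s)).congr_deriv ?_
  have := abs_rpow_sub_mul_pow (k := 2) (by exact_mod_cast hm) s
  rw [sq_abs] at this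
  simp only [id, mul_one]
  push_cast at this
  linear_combination m * this

theorem abs_deriv_abs_rpow {q : ℝ} (hq : 2 < q) (s : ℝ) :
    |q * |s| ^ (q - 2) * s| = q * |s| ^ (q - 1) := by
  rw [abs_mul, abs_mul, abs_of_nonneg (by positivity : 0 ≤ |s| ^ (q - 2)), abs_of_pos (by linarith),
    mul_assoc]
  congr 1
  have := abs_rpow_sub_mul_pow (q := q - 1) (k := 1) (by push_cast; linarith) s
  rw [pow_one] at this
  rw [← this]
  congr 2
  push_cast; ring

theorem caccioppoliConst_nonneg {n : ℕ} {K : ℝ} (hK : 0 < K) : 0 ≤ caccioppoliConst n K := by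
  rw [caccioppoliConst]; positivity

/-- Caccioppoli's inequality for powers of a coordinate. -/
theorem QROn.lintegral_caccioppoli_rpow {n : ℕ} (hn : 2 ≤ n) {K : ℝ} (hK : 0 < K) {U : Set (Vec n)}
    {f : Vec n → Vec n} (hf : QROn n K U f) {x₀ : Vec n} {R R' : ℝ} (hR : 0 < R) (hRR : R < R')
    (hRU : closedBall x₀ R' ⊆ U) {φ : Vec n → ℝ}
    (hφ : ContDiff ℝ 1 φ) (hφ0 : ∀ x, 0 ≤ φ x) (hφs : tsupport φ ⊆ closedBall x₀ R) {l : ℝ}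
    (hl : ∀ x, ‖fderiv ℝ φ x‖ ≤ l) (i : Fin n) {q : ℝ} (hq : (n : ℝ) + 2 < q) :
    AEMeasurable (fun x => ENNReal.ofReal
      (φ x ^ n * ((q - n + 1) * |f x i| ^ (q - n)) * ‖fderiv ℝ f x‖ ^ n)) ∧
    ∫⁻ x, ENNReal.ofReal (φ x ^ n * ((q - n + 1) * |f x i| ^ (q - n)) * ‖fderiv ℝ f x‖ ^ n)
      ≤ ENNReal.ofReal (caccioppoliConst n K * ((q - n + 1) * l ^ n))
        * ∫⁻ x in closedBall x₀ R, ENNReal.ofReal (|f x i| ^ q) := by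
  have hm : 0 < q - n + 1 := by linarith
  have hcK := caccioppoliConst_nonneg (n := n) hK
  obtain ⟨h1, h2, h3⟩ := hf.caccioppoli hn hK hR hRR hRU
    ((hf.locallyIntegrableOn hn hK).integrableOn_compact_subset hRU (isCompact_closedBall _ _))
    hφ hφ0 hφs i (v := fun t => |t| ^ (q - n) * t) (v' := fun s => (q - n + 1) * |s| ^ (q - n))
    (w := fun s => |s|) (hasDerivAt_abs_rpow_mul_self (by linarith))
    (continuous_const.mul (continuous_abs.rpow_const fun _ => Or.inr (by linarith)))
    (fun s => by positivity)
    (fun s => by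
      rw [abs_mul, abs_of_nonneg (by positivity : 0 ≤ |s| ^ (q - n)), mul_comm]
      gcongr
      have : 0 ≤ |s| ^ (q - n) := by positivity
      nlinarith)
    continuous_abs (fun s => abs_nonneg s)
  refine ⟨h1.aestronglyMeasurable.aemeasurable.ennreal_ofReal, ?_⟩
  rw [← ofReal_integral_eq_lintegral_ofReal h1 (Eventually.of_forall fun x => by
    have := hφ0 x; positivity)]
  refine (ENNReal.ofReal_le_ofReal h3).trans ?_
  rw [ENNReal.ofReal_mul hcK, ENNReal.ofReal_mul hcK, mul_assoc]
  gcongr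
  rw [ofReal_integral_eq_lintegral_ofReal h2 (Eventually.of_forall fun x => by positivity),
    ← lintegral_const_mul' _ _ ENNReal.ofReal_ne_top,
    ← lintegral_indicator isClosed_closedBall.measurableSet]
  refine lintegral_mono fun x => ?_
  have hl0 : 0 ≤ l := (norm_nonneg _).trans (hl x)
  by_cases hx : x ∈ closedBall x₀ R
  · rw [indicator_of_mem hx, ← ENNReal.ofReal_mul (by positivity)]
    refine ENNReal.ofReal_le_ofReal ?_
    rw [mul_assoc (q - n + 1), abs_rpow_sub_mul_pow (by linarith), mul_right_comm]
    gcongr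
    exact hl x
  · have : fderiv ℝ φ x = 0 := by
      by_contra h
      exact hx (hφs (support_fderiv_subset ℝ h))
    rw [indicator_of_notMem hx, this, norm_zero, zero_pow (by omega), mul_zero, ENNReal.ofReal_zero]

theorem hasFDerivAt_pow_mul_abs_rpow {n : ℕ} {φ : Vec n → ℝ} {f : Vec n → Vec n} {x : Vec n}
    (hφ : DifferentiableAt ℝ φ x) (hf : DifferentiableAt ℝ f x) (i : Fin n) {q : ℝ} (hq : 1 < q) :
    HasFDerivAt (fun y => φ y ^ n * |f y i| ^ q)
      ((n * φ x ^ (n - 1) * |f x i| ^ q) • fderiv ℝ φ x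
        + (φ x ^ n * (q * |f x i| ^ (q - 2) * f x i)) • rowOf (fderiv ℝ f x) i) x := by
  refine ((hφ.hasFDerivAt.pow n).mul ((hasDerivAt_abs_rpow (f x i) hq).comp_hasFDerivAt x
    (hasFDerivAt_rowOf hf i))).congr_fderiv ?_
  ext y
  simp
  ring

theorem norm_fderiv_pow_mul_abs_rpow_le {n : ℕ} (hn : 2 ≤ n) {φ : Vec n → ℝ} {f : Vec n → Vec n}
    {x : Vec n} (hφ : DifferentiableAt ℝ φ x) (hf : DifferentiableAt ℝ f x) (hφ0 : 0 ≤ φ x)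
    (hφ1 : φ x ≤ 1) {l : ℝ} (hl0 : 0 < l) (hl : ‖fderiv ℝ φ x‖ ≤ l) (i : Fin n) {q : ℝ}
    (hq : (n : ℝ) + 2 < q) :
    ‖fderiv ℝ (fun y => φ y ^ n * |f y i| ^ q) x‖ ≤ 2 * q * l * |f x i| ^ q
      + q * l / (l ^ n * (q - n + 1))
        * (φ x ^ n * ((q - n + 1) * |f x i| ^ (q - n)) * ‖fderiv ℝ f x‖ ^ n) := by
  have hn' : (2 : ℝ) ≤ n := by exact_mod_cast hn
  have hm : 0 < q - n + 1 := by linarith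
  have hq0 : 0 < q := by linarith
  rw [(hasFDerivAt_pow_mul_abs_rpow hφ hf i (by linarith)).fderiv]
  set A := fderiv ℝ f x
  set s := |f x i| with hs
  have hs0 : 0 ≤ s := abs_nonneg _
  have hsq : s ^ (q - n) * s ^ n = s ^ q := abs_rpow_sub_mul_pow (by linarith) _
  have hsq1 : s ^ (q - n) * s ^ (n - 1) = s ^ (q - 1) := by
    have := abs_rpow_sub_mul_pow (q := q - 1) (k := n - 1)
      (by rw [Nat.cast_sub (by omega)]; push_cast; linarith) (f x i)
    rw [← this]
    congr 2
    rw [Nat.cast_sub (by omega)]; push_cast; ring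
  have hY := mul_pow_pred_mul_le (n := n) (by omega) (C := 1) (ε := 1) (a := s) (b := ‖A‖ / l)
    zero_le_one one_pos hs0 (by positivity)
  simp only [one_mul, div_one, one_pow] at hY
  have hY2 : s ^ (n - 1) * ‖A‖ ≤ l * s ^ n + l * (‖A‖ / l) ^ n := by
    have := mul_le_mul_of_nonneg_left hY hl0.le
    calc s ^ (n - 1) * ‖A‖ = l * (s ^ (n - 1) * (‖A‖ / l)) := by field_simp
      _ ≤ _ := by linarith
  calc ‖(n * φ x ^ (n - 1) * s ^ q) • fderiv ℝ φ x
        + (φ x ^ n * (q * s ^ (q - 2) * f x i)) • rowOf A i‖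
      ≤ n * φ x ^ (n - 1) * s ^ q * ‖fderiv ℝ φ x‖ + φ x ^ n * (q * s ^ (q - 1)) * ‖A‖ := by
        refine (norm_add_le _ _).trans (add_le_add ?_ ?_)
        · rw [norm_smul, Real.norm_of_nonneg (by positivity)]
        · rw [norm_smul, Real.norm_eq_abs, abs_mul, abs_of_nonneg (pow_nonneg hφ0 n),
            abs_deriv_abs_rpow (by linarith)]
          gcongr
          exact norm_rowOf_le _ _
    _ ≤ q * 1 * s ^ q * l + φ x ^ n * q * s ^ (q - n) * (l * s ^ n + l * (‖A‖ / l) ^ n) := by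
        refine add_le_add ?_ ?_
        · gcongr
          · linarith
          · exact pow_le_one₀ hφ0 hφ1
        · rw [← hsq1]
          calc φ x ^ n * (q * (s ^ (q - n) * s ^ (n - 1))) * ‖A‖
              = φ x ^ n * q * s ^ (q - n) * (s ^ (n - 1) * ‖A‖) := by ring
            _ ≤ _ := by gcongr
    _ = q * l * s ^ q + φ x ^ n * (q * l * s ^ q) + q * l / (l ^ n * (q - n + 1))
        * (φ x ^ n * ((q - n + 1) * s ^ (q - n)) * ‖A‖ ^ n) := by
        rw [← hsq, div_pow]; field_simp; ring
    _ ≤ _ := by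
        have h1 : φ x ^ n * (q * l * s ^ q) ≤ 1 * (q * l * s ^ q) := by
          gcongr
          exact pow_le_one₀ hφ0 hφ1
        linarith

theorem exists_moser_step {n : ℕ} (hn : 2 ≤ n) {K : ℝ} (hK : 0 < K) : ∃ C : ℝ, 0 < C ∧
    ∀ {U : Set (Vec n)} {f : Vec n → Vec n}, QROn n K U f → ∀ (i : Fin n) {x₀ : Vec n}
      {d r R q : ℝ}, 0 < r → r < R → R ≤ d → closedBall x₀ (2 * d) ⊆ U → (n : ℝ) + 2 < q →
      ∫⁻ x in closedBall x₀ r, ENNReal.ofReal (|f x i| ^ (q * ((n : ℝ) / (n - 1))))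
        ≤ (ENNReal.ofReal (C * q / (R - r))
          * ∫⁻ x in closedBall x₀ R, ENNReal.ofReal (|f x i| ^ q)) ^ ((n : ℝ) / (n - 1)) := by
  obtain ⟨C₀, hC₀, hcut⟩ := exists_cutoff
  obtain ⟨S, hS, hsob⟩ := exists_sobolev_const hn
  have hcK := caccioppoliConst_nonneg (n := n) hK
  have hn' : (2 : ℝ) ≤ n := by exact_mod_cast hn
  refine ⟨S * ((2 + caccioppoliConst n K) * C₀), by positivity, ?_⟩
  intro U f hf i x₀ d r R q hr hrR hRd hU hq
  obtain ⟨φ, hφ, hφ0, hφ1, hφr, hφs, hφD⟩ := hcut x₀ hr hrR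
  have hm : 0 < q - n + 1 := by linarith
  have hq0 : 0 < q := by linarith
  have hRr : 0 < R - r := by linarith
  set l := C₀ / (R - r) with hl
  have hl0 : 0 < l := by positivity
  have hBU : closedBall x₀ R ⊆ U := (closedBall_subset_closedBall (by linarith)).trans hU
  obtain ⟨hPm, hP⟩ := hf.lintegral_caccioppoli_rpow hn hK (by linarith) (by linarith : R < 2 * d)
    hU hφ hφ0 hφs hφD i hq
  set J := ∫⁻ x in closedBall x₀ R, ENNReal.ofReal (|f x i| ^ q) with hJ
  set g : Vec n → ℝ := fun y => φ y ^ n * |f y i| ^ q with hg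
  have hφd : Differentiable ℝ φ := hφ.differentiable one_ne_zero
  have hgs : tsupport g ⊆ closedBall x₀ R := by
    refine closure_minimal (fun x hx => hφs (subset_tsupport _ fun h0 => hx ?_)) isClosed_closedBall
    simp only [hg, h0, zero_pow (by omega : n ≠ 0), zero_mul]
  have hgd : Differentiable ℝ g := differentiable_of_tsupport fun x hx =>
    (hasFDerivAt_pow_mul_abs_rpow (hφd x) (hf.differentiableAt x (hBU (hgs hx))) i
      (by linarith)).differentiableAt
  have hgc : HasCompactSupport g := (isCompact_closedBall x₀ R).of_isClosed_subset
    (isClosed_tsupport g) hgs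
  have hDg : ∫⁻ x, ENNReal.ofReal ‖fderiv ℝ g x‖
      ≤ ENNReal.ofReal ((2 + caccioppoliConst n K) * C₀ * q / (R - r)) * J := by
    calc ∫⁻ x, ENNReal.ofReal ‖fderiv ℝ g x‖
        ≤ ∫⁻ x, ((closedBall x₀ R).indicator
            (fun x => ENNReal.ofReal (2 * q * l) * ENNReal.ofReal (|f x i| ^ q)) x
          + ENNReal.ofReal (q * l / (l ^ n * (q - n + 1))) * ENNReal.ofReal
            (φ x ^ n * ((q - n + 1) * |f x i| ^ (q - n)) * ‖fderiv ℝ f x‖ ^ n)) := by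
          refine lintegral_mono fun x => ?_
          by_cases hx : x ∈ closedBall x₀ R
          · have := hφ0 x
            rw [indicator_of_mem hx, ← ENNReal.ofReal_mul (by positivity),
              ← ENNReal.ofReal_mul (by positivity),
              ← ENNReal.ofReal_add (by positivity) (by positivity)]
            exact ENNReal.ofReal_le_ofReal (norm_fderiv_pow_mul_abs_rpow_le hn (hφd x)
              (hf.differentiableAt x (hBU hx)) (hφ0 x) (hφ1 x) hl0 (hφD x) i hq)
          · have : fderiv ℝ g x = 0 := by
              by_contra h
              exact hx (hgs (support_fderiv_subset ℝ h))
            rw [this, norm_zero, ENNReal.ofReal_zero]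
            exact zero_le
      _ ≤ ENNReal.ofReal (2 * q * l) * J + ENNReal.ofReal (q * l / (l ^ n * (q - n + 1)))
          * (ENNReal.ofReal (caccioppoliConst n K * ((q - n + 1) * l ^ n)) * J) := by
          rw [lintegral_add_right' _ (hPm.const_mul _),
            lintegral_indicator isClosed_closedBall.measurableSet,
            lintegral_const_mul' _ _ ENNReal.ofReal_ne_top,
            lintegral_const_mul' _ _ ENNReal.ofReal_ne_top]
          gcongr
      _ = _ := by
          rw [← mul_assoc, ← ENNReal.ofReal_mul (by positivity), ← add_mul,
            ← ENNReal.ofReal_add (by positivity) (by positivity)]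
          congr 2
          rw [hl]
          field_simp
  calc ∫⁻ x in closedBall x₀ r, ENNReal.ofReal (|f x i| ^ (q * ((n : ℝ) / (n - 1))))
      = ∫⁻ x in closedBall x₀ r, ENNReal.ofReal (|g x| ^ ((n : ℝ) / (n - 1))) := by
        refine setLIntegral_congr_fun isClosed_closedBall.measurableSet fun x hx => ?_
        simp only [hg, hφr x hx, one_pow, one_mul]
        rw [abs_of_nonneg (by positivity : 0 ≤ |f x i| ^ q), Real.rpow_mul (abs_nonneg _)]
    _ ≤ ∫⁻ x, ENNReal.ofReal (|g x| ^ ((n : ℝ) / (n - 1))) := setLIntegral_le_lintegral _ _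
    _ ≤ (ENNReal.ofReal S * ∫⁻ x, ENNReal.ofReal ‖fderiv ℝ g x‖) ^ ((n : ℝ) / (n - 1)) :=
        hsob hgd hgc
    _ ≤ _ := by
        refine ENNReal.rpow_le_rpow ?_ (div_nonneg (by linarith) (by linarith))
        refine (mul_le_mul_right hDg _).trans_eq ?_
        rw [← mul_assoc, ← ENNReal.ofReal_mul hS.le]
        congr 2
        ring

theorem pow_pred_rpow_div {n : ℕ} (hn : 2 ≤ n) {a : ℝ} (ha : 0 ≤ a) :
    (a ^ (n - 1)) ^ ((n : ℝ) / (n - 1)) = a ^ n := by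
  have hn' : (2 : ℝ) ≤ n := by exact_mod_cast hn
  rw [← Real.rpow_natCast a (n - 1), ← Real.rpow_mul ha, Nat.cast_sub (by omega), Nat.cast_one,
    mul_div_cancel₀ _ (by linarith), Real.rpow_natCast]

/-- Moser iteration: smallness of an `L^q` norm on a ball controls the value at the centre. -/
theorem exists_forall_abs_le_one {n : ℕ} (hn : 2 ≤ n) {K : ℝ} (hK : 0 < K) {q : ℝ}
    (hq : (n : ℝ) + 2 < q) : ∃ ε : ℝ, 0 < ε ∧
    ∀ {U : Set (Vec n)} {f : Vec n → Vec n}, QROn n K U f → ∀ (i : Fin n) {x₀ : Vec n} {d : ℝ},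
      0 < d → closedBall x₀ (2 * d) ⊆ U →
      ∫⁻ x in closedBall x₀ d, ENNReal.ofReal (|f x i| ^ q) ≤ ENNReal.ofReal (d ^ n * ε) →
      |f x₀ i| ≤ 1 := by
  obtain ⟨C, hC, hstep⟩ := exists_moser_step hn hK
  have hn' : (2 : ℝ) ≤ n := by exact_mod_cast hn
  set χ : ℝ := (n : ℝ) / (n - 1) with hχ
  have hχ1 : 1 < χ := by rw [hχ, one_lt_div (by linarith)]; linarith
  set D : ℝ := 2 * χ with hD
  have hD1 : 1 < D := by linarith
  have hq0 : 0 < q := by linarith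
  refine ⟨(D / (4 * C * q * D ^ n)) ^ n, by positivity, ?_⟩
  intro U f hf i x₀ d hd hU hA
  set ρ : ℕ → ℝ := fun k => d * (1 / 2 + (1 / 2) ^ (k + 1)) with hρ
  have hρd : ∀ k, ρ k ≤ d := fun k => by
    have : ((1 : ℝ) / 2) ^ (k + 1) ≤ (1 / 2) ^ 1 :=
      pow_le_pow_of_le_one (by norm_num) (by norm_num) (by omega)
    simp only [hρ]
    nlinarith
  have hρ2 : ∀ k, d / 2 ≤ ρ k := fun k => by
    have : (0 : ℝ) < (1 / 2) ^ (k + 1) := by positivity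
    simp only [hρ]
    nlinarith
  set S : ℕ → ℝ := fun k => d * D / (4 * C * q * D ^ n * D ^ k) with hS
  have key : ∀ k, ∫⁻ x in closedBall x₀ (ρ k), ENNReal.ofReal (|f x i| ^ (q * χ ^ k))
      ≤ ENNReal.ofReal (S k ^ n) := by
    intro k
    induction k with
    | zero =>
      have h1 : ρ 0 = d := by simp only [hρ]; ring
      have h2 : S 0 ^ n = d ^ n * (D / (4 * C * q * D ^ n)) ^ n := by
        rw [← mul_pow]; simp only [hS]; rw [pow_zero, mul_one, mul_div_assoc]
      rw [h1, h2, pow_zero, mul_one]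
      exact hA
    | succ k ih =>
      have hlt : ρ (k + 1) < ρ k := by
        have : (0 : ℝ) < (1 / 2) ^ (k + 1) := by positivity
        simp only [hρ]
        rw [pow_succ (1 / 2 : ℝ) (k + 1)]
        nlinarith
      have hqk : (n : ℝ) + 2 < q * χ ^ k :=
        hq.trans_le (le_mul_of_one_le_right hq0.le (one_le_pow₀ hχ1.le))
      have h := hstep hf i (by linarith [hρ2 (k + 1)]) hlt (hρd k) hU hqk
      rw [pow_succ, ← mul_assoc]
      refine h.trans ?_
      calc (ENNReal.ofReal (C * (q * χ ^ k) / (ρ k - ρ (k + 1))) * _) ^ χ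
          ≤ (ENNReal.ofReal (S (k + 1) ^ (n - 1))) ^ χ := by
            refine ENNReal.rpow_le_rpow ?_ (by linarith)
            refine (mul_le_mul_right ih _).trans_eq ?_
            have hρk : ρ k - ρ (k + 1) = d / (4 * 2 ^ k) := by
              simp only [hρ, one_div, inv_pow, pow_succ]
              field_simp
              ring
            rw [hρk, ← ENNReal.ofReal_mul (by positivity)]
            congr 1
            have hSk : S k = D * S (k + 1) := by
              simp only [hS, pow_succ]
              field_simp
            have hpow : S k ^ n = D ^ (n - 1) * S (k + 1) ^ (n - 1) * S k := by
              rw [← mul_pow, ← hSk, ← pow_succ]; congr 1; omega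
            rw [hpow]
            have hDn : D ^ n = D ^ (n - 1) * D := by rw [← pow_succ]; congr 1; omega
            simp only [hS]
            rw [hDn, hD, mul_pow 2 χ k]
            field_simp
        _ = ENNReal.ofReal (S (k + 1) ^ n) := by
            rw [ENNReal.ofReal_rpow_of_nonneg (by positivity) (by linarith),
              pow_pred_rpow_div hn (by positivity)]
  by_contra! hlt
  have hcont : ContinuousAt (fun x => |f x i|) x₀ :=
    (hasFDerivAt_rowOf (hf.differentiableAt x₀ (hU (mem_closedBall_self (by positivity)))) i
      |>.continuousAt).abs
  obtain ⟨δ, hδ, hball⟩ := Metric.eventually_nhds_iff_ball.1 (hcont.eventually_const_lt hlt)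
  set B := ball x₀ (min δ (d / 2)) with hB
  have hBpos : 0 < volume B := measure_ball_pos _ _ (by positivity)
  have hle : ∀ k, volume B ≤ ENNReal.ofReal (S k ^ n) := fun k => by
    refine le_trans ?_ (key k)
    calc volume B = ∫⁻ x in B, 1 := by simp
      _ ≤ ∫⁻ x in B, ENNReal.ofReal (|f x i| ^ (q * χ ^ k)) := by
          refine setLIntegral_mono' measurableSet_ball fun x hx => ?_
          rw [← ENNReal.ofReal_one]
          exact ENNReal.ofReal_le_ofReal (Real.one_le_rpow
            (hball x (ball_subset_ball (min_le_left _ _) hx)).le (by positivity))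
      _ ≤ _ := lintegral_mono_set (ball_subset_closedBall.trans
          (closedBall_subset_closedBall ((min_le_right _ _).trans (hρ2 k))))
  have hS0 : Tendsto S atTop (𝓝 0) := by
    have := (tendsto_pow_atTop_nhds_zero_of_lt_one (r := D⁻¹) (by positivity)
      (inv_lt_one_of_one_lt₀ hD1)).const_mul (d * D / (4 * C * q * D ^ n))
    rw [mul_zero] at this
    refine this.congr fun k => ?_
    simp only [hS, inv_pow]
    rw [← div_eq_mul_inv, div_div]
  have hlim := ENNReal.tendsto_ofReal (hS0.pow n)
  rw [zero_pow (by omega), ENNReal.ofReal_zero] at hlim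
  exact hBpos.not_ge (ge_of_tendsto' hlim hle)

theorem IsQR.qrOn {n : ℕ} {K : ℝ} {f : Vec n → Vec n} (hf : IsQR n K f) :
    QROn n K (unitBall n) f :=
  ⟨isOpen_ball, hf.2.1, (ae_restrict_iff' measurableSet_ball).1 hf.2.2⟩

theorem QROn.smul {n : ℕ} {K : ℝ} {U : Set (Vec n)} {f : Vec n → Vec n} (hf : QROn n K U f)
    {t : ℝ} (ht : 0 ≤ t) : QROn n K U (t • f) := by
  refine ⟨hf.isOpen, fun x hx => (hf.differentiableAt x hx).const_smul t, ?_⟩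
  filter_upwards [hf.distortion] with x hx hxU
  have hdet : (t • fderiv ℝ f x).det = t ^ n * (fderiv ℝ f x).det := by
    have := LinearMap.det_smul t (fderiv ℝ f x : Vec n →ₗ[ℝ] Vec n)
    rw [finrank_euclideanSpace_fin] at this
    exact this
  rw [fderiv_const_smul (hf.differentiableAt x hxU), norm_smul, Real.norm_of_nonneg ht, mul_pow,
    hdet, mul_left_comm]
  exact mul_le_mul_of_nonneg_left (hx hxU) (by positivity)

theorem exists_norm_le_mul_abs_apply {n : ℕ} (hn : 0 < n) (v : Vec n) :
    ∃ i, ‖v‖ ≤ n * |v i| := by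
  have : Nonempty (Fin n) := ⟨⟨0, hn⟩⟩
  obtain ⟨i, hi⟩ := Finite.exists_max fun i => |v i|
  refine ⟨i, ?_⟩
  have hv : v = ∑ j, EuclideanSpace.single j (v j) := by
    ext k
    simp
  calc ‖v‖ = ‖∑ j, EuclideanSpace.single j (v j)‖ := by rw [← hv]
    _ ≤ ∑ j, ‖EuclideanSpace.single j (v j)‖ := norm_sum_le _ _
    _ ≤ ∑ _j : Fin n, |v i| := Finset.sum_le_sum fun j _ => by simpa using hi j
    _ = n * |v i| := by simp

/-- Pointwise growth of a quasiregular map in the Bergman space `A^p`. -/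
theorem IsQR.exists_growth_bound {n : ℕ} (hn : 2 ≤ n) {K p : ℝ} (hK : 0 < K) (hp : 0 < p)
    {f : Vec n → Vec n} (hf : IsQR n K f)
    (hA : ∫⁻ x in unitBall n, ENNReal.ofReal (‖f x‖ ^ p) < ⊤) :
    ∃ C : ℝ, 0 ≤ C ∧ ∀ x ∈ unitBall n, (1 - ‖x‖) ^ n * ‖f x‖ ^ p ≤ C := by
  have hn' : (2 : ℝ) ≤ n := by exact_mod_cast hn
  set q := max p (n + 3) with hq
  have hpq : p ≤ q := le_max_left _ _
  obtain ⟨ε, hε, hmoser⟩ := exists_forall_abs_le_one hn hK (q := q)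
    (by linarith [le_max_right p ((n : ℝ) + 3)])
  set I := (∫⁻ x in unitBall n, ENNReal.ofReal (‖f x‖ ^ p)).toReal with hI
  have hI0 : 0 ≤ I := ENNReal.toReal_nonneg
  set M : ℝ := (2 ^ n) ^ p⁻¹ with hM
  have hM0 : 0 < M := by positivity
  set C := 4 ^ n * ((2 * n * M) ^ (q - p) * (2 * n) ^ p * I) / ε with hC
  refine ⟨2 ^ n * C, by positivity, fun x₀ hx₀ => ?_⟩
  rw [unitBall, mem_ball_zero_iff] at hx₀
  by_cases h0 : f x₀ = 0
  · rw [h0, norm_zero, Real.zero_rpow hp.ne', mul_zero]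
    positivity
  set ρ := (1 + ‖x₀‖) / 2 with hρ
  have hsub : closedBall (0 : Vec n) ρ ⊆ unitBall n := closedBall_subset_ball (by linarith)
  set h : Vec n → ℝ := fun x => (ρ - ‖x‖) ^ n * ‖f x‖ ^ p with hh
  have hcont : ContinuousOn h (closedBall 0 ρ) := by
    refine ContinuousOn.mul (by fun_prop) ?_
    exact (hf.1.mono hsub).norm.rpow_const fun _ _ => Or.inr hp.le
  obtain ⟨x₁, hx₁, hmax⟩ := (isCompact_closedBall (0 : Vec n) ρ).exists_isMaxOn
    ⟨x₀, by rw [mem_closedBall_zero_iff]; linarith⟩ hcont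
  have hle : ∀ x, ‖x‖ ≤ ρ → h x ≤ h x₁ := fun x hx => hmax (mem_closedBall_zero_iff.2 hx)
  rw [mem_closedBall_zero_iff] at hx₁
  have hpos : 0 < h x₁ := by
    refine lt_of_lt_of_le ?_ (hle x₀ (by linarith))
    have := norm_pos_iff.2 h0
    have : 0 < ρ - ‖x₀‖ := by linarith
    simp only [hh]
    positivity
  have hN : 0 < ‖f x₁‖ := by
    rw [norm_pos_iff]
    intro h0
    simp [hh, h0, Real.zero_rpow hp.ne'] at hpos
  set N := ‖f x₁‖ with hNdef
  have hs : 0 < ρ - ‖x₁‖ := by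
    refine lt_of_le_of_ne (by linarith) fun h0 => ?_
    simp [hh, ← h0, show n ≠ 0 by omega] at hpos
  set s := ρ - ‖x₁‖ with hsdef
  have hloc : ∀ x ∈ closedBall x₁ (2 * (s / 4)), ‖x‖ ≤ ρ - s / 2 := fun x hx => by
    rw [mem_closedBall, dist_eq_norm] at hx
    have := norm_le_norm_add_norm_sub x₁ x
    rw [norm_sub_rev] at this
    linarith
  have hbd : ∀ x ∈ closedBall x₁ (2 * (s / 4)), ‖f x‖ ≤ M * N := fun x hx => by
    have hx' := hloc x hx
    have h1 : (s / 2) ^ n * ‖f x‖ ^ p ≤ s ^ n * N ^ p :=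
      (mul_le_mul_of_nonneg_right (pow_le_pow_left₀ (by positivity) (by linarith) n)
        (by positivity)).trans (hle x (by linarith))
    have h2 : ‖f x‖ ^ p ≤ (M * N) ^ p := by
      rw [Real.mul_rpow hM0.le hN.le, hM, Real.rpow_inv_rpow (by positivity) hp.ne']
      rw [div_pow, div_mul_eq_mul_div, div_le_iff₀ (by positivity)] at h1
      refine le_of_mul_le_mul_left (h1.trans_eq ?_) (by positivity : 0 < s ^ n)
      ring
    exact (Real.rpow_le_rpow_iff (norm_nonneg _) (by positivity) hp).1 h2
  obtain ⟨i, hi⟩ := exists_norm_le_mul_abs_apply (by omega) (f x₁)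
  set t := 2 * n / N with ht
  have ht0 : 0 < t := by positivity
  have hU : closedBall x₁ (2 * (s / 4)) ⊆ unitBall n := fun x hx =>
    hsub (mem_closedBall_zero_iff.2 (by linarith [hloc x hx]))
  have hbig : ¬ |(t • f) x₁ i| ≤ 1 := by
    have : 2 ≤ t * |f x₁ i| := by
      rw [ht, div_mul_eq_mul_div, le_div_iff₀ hN]
      linarith
    simp only [Pi.smul_apply, PiLp.smul_apply, smul_eq_mul, abs_mul, abs_of_pos ht0]
    linarith
  have hinteg := lt_of_not_ge (mt (hmoser (hf.qrOn.smul ht0.le) i (by positivity) hU) hbig)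
  have hmain : ENNReal.ofReal ((s / 4) ^ n * ε)
      ≤ ENNReal.ofReal ((2 * n * M) ^ (q - p) * t ^ p * I) := by
    refine hinteg.le.trans ?_
    calc ∫⁻ x in closedBall x₁ (s / 4), ENNReal.ofReal (|(t • f) x i| ^ q)
        ≤ ∫⁻ x in closedBall x₁ (s / 4), ENNReal.ofReal ((2 * n * M) ^ (q - p) * t ^ p)
            * ENNReal.ofReal (‖f x‖ ^ p) := by
          refine setLIntegral_mono' measurableSet_closedBall fun x hx => ?_
          rw [← ENNReal.ofReal_mul (by positivity)]
          refine ENNReal.ofReal_le_ofReal ?_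
          have hx' := hbd x (closedBall_subset_closedBall (by linarith) hx)
          have h1 : |(t • f) x i| ≤ t * ‖f x‖ := by
            simp only [Pi.smul_apply, PiLp.smul_apply, smul_eq_mul, abs_mul, abs_of_pos ht0]
            exact mul_le_mul_of_nonneg_left (PiLp.norm_apply_le (f x) i) ht0.le
          have h2 : t * ‖f x‖ ≤ 2 * n * M := by
            refine (mul_le_mul_of_nonneg_left hx' ht0.le).trans_eq ?_
            rw [ht]
            field_simp
          calc |(t • f) x i| ^ q ≤ (t * ‖f x‖) ^ q :=
                Real.rpow_le_rpow (abs_nonneg _) h1 (by linarith)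
            _ = (t * ‖f x‖) ^ (q - p) * (t * ‖f x‖) ^ p := by
                rw [← Real.rpow_add_of_nonneg (by positivity) (by linarith) hp.le, sub_add_cancel]
            _ ≤ (2 * n * M) ^ (q - p) * (t * ‖f x‖) ^ p := by
                gcongr
            _ = _ := by rw [Real.mul_rpow ht0.le (norm_nonneg _)]; exact (mul_assoc _ _ _).symm
      _ = ENNReal.ofReal ((2 * n * M) ^ (q - p) * t ^ p)
            * ∫⁻ x in closedBall x₁ (s / 4), ENNReal.ofReal (‖f x‖ ^ p) :=
          lintegral_const_mul' _ _ ENNReal.ofReal_ne_top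
      _ ≤ ENNReal.ofReal ((2 * n * M) ^ (q - p) * t ^ p) * ENNReal.ofReal I := by
          rw [hI, ENNReal.ofReal_toReal hA.ne]
          gcongr
          exact (closedBall_subset_closedBall (by linarith)).trans hU
      _ = _ := (ENNReal.ofReal_mul (by positivity)).symm
  rw [ENNReal.ofReal_le_ofReal_iff (by positivity), ht, Real.div_rpow (by positivity) hN.le] at hmain
  have hx₁C : h x₁ ≤ C := by
    have hNp : 0 < N ^ p := by positivity
    rw [hC, le_div_iff₀ hε]
    have h4 : s ^ n = 4 ^ n * (s / 4) ^ n := by rw [← mul_pow]; congr 1; ring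
    have := mul_le_mul_of_nonneg_left hmain (by positivity : 0 ≤ 4 ^ n * N ^ p)
    calc h x₁ * ε = s ^ n * N ^ p * ε := rfl
      _ = 4 ^ n * N ^ p * ((s / 4) ^ n * ε) := by rw [h4]; ring
      _ ≤ _ := this
      _ = _ := by field_simp
  have hx₀C := (hle x₀ (by linarith)).trans hx₁C
  calc (1 - ‖x₀‖) ^ n * ‖f x₀‖ ^ p = 2 ^ n * h x₀ := by
        simp only [hh, hρ]
        rw [← mul_assoc, ← mul_pow]
        congr 2
        ring
    _ ≤ 2 ^ n * C := by gcongr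

theorem lintegral_one_sub_rpow_lt_top {a : ℝ} (ha : -1 < a) :
    ∫⁻ r in Ioo (0 : ℝ) 1, ENNReal.ofReal ((1 - r) ^ a) < ⊤ := by
  have h := (intervalIntegral.intervalIntegrable_rpow' (a := 0) (b := 1) ha).comp_sub_left 1
  rw [sub_zero, sub_self] at h
  have h' := ((intervalIntegrable_iff_integrableOn_Ioo_of_le zero_le_one).1 h.symm).hasFiniteIntegral
  refine lt_of_eq_of_lt (setLIntegral_congr_fun measurableSet_Ioo fun r hr => ?_) h'
  have : 0 ≤ 1 - r := by linarith [hr.2]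
  rw [← Real.enorm_of_nonneg (by positivity)]

theorem bergman_to_radial_maximal (n : ℕ) (hn : 2 ≤ n) (K p : ℝ) (hK : 1 ≤ K)
    (hp : 0 < p) (f : Vec n → Vec n) (hf : IsQR n K f) (hf0 : ∀ x ∈ unitBall n, f x ≠ 0)
    (hA : ∫⁻ x in unitBall n, ENNReal.ofReal (‖f x‖ ^ p) < ⊤) :
    ∀ p' : ℝ, 0 < p' → p' < p * ((n : ℝ) - 1) / n →
      ∫⁻ r in Set.Ioo (0 : ℝ) 1,
          ENNReal.ofReal ((1 - r) ^ ((n : ℝ) - 2)) *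
            (⨆ x ∈ Metric.sphere (0 : Vec n) r, ENNReal.ofReal ‖f x‖) ^ p' < ⊤ := by
  intro p' hp' hlt
  have hn' : (2 : ℝ) ≤ n := by exact_mod_cast hn
  obtain ⟨C, hC, hgrowth⟩ := hf.exists_growth_bound hn (by linarith) hp hA
  have ha : -1 < (n : ℝ) - 2 - n * (p' / p) := by
    have : n * (p' / p) < n - 1 := by
      rw [lt_div_iff₀ (by linarith)] at hlt
      rw [← mul_div_assoc, div_lt_iff₀ hp]
      linarith
    linarith
  refine lt_of_le_of_lt (setLIntegral_mono' measurableSet_Ioo (g := fun r =>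
    ENNReal.ofReal (C ^ (p' / p)) * ENNReal.ofReal ((1 - r) ^ ((n : ℝ) - 2 - n * (p' / p))))
    fun r hr => ?_) ?_
  · have hr1 : 0 < 1 - r := by linarith [hr.2]
    have hsup : ⨆ x ∈ sphere (0 : Vec n) r, ENNReal.ofReal ‖f x‖
        ≤ ENNReal.ofReal ((C / (1 - r) ^ n) ^ p⁻¹) := by
      refine iSup₂_le fun x hx => ENNReal.ofReal_le_ofReal ?_
      rw [mem_sphere_zero_iff_norm] at hx
      have := hgrowth x (by rw [unitBall, mem_ball_zero_iff, hx]; exact hr.2)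
      rw [hx, mul_comm, ← le_div_iff₀ (by positivity)] at this
      exact (Real.le_rpow_inv_iff_of_pos (norm_nonneg _) (by positivity) hp).2 this
    calc ENNReal.ofReal ((1 - r) ^ ((n : ℝ) - 2)) * _
        ≤ ENNReal.ofReal ((1 - r) ^ ((n : ℝ) - 2))
            * ENNReal.ofReal ((C / (1 - r) ^ n) ^ p⁻¹) ^ p' := by gcongr
      _ = ENNReal.ofReal (C ^ (p' / p))
            * ENNReal.ofReal ((1 - r) ^ ((n : ℝ) - 2 - n * (p' / p))) := by
          rw [ENNReal.ofReal_rpow_of_nonneg (by positivity) hp'.le,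
            ← ENNReal.ofReal_mul (by positivity), ← ENNReal.ofReal_mul (by positivity),
            ← Real.rpow_mul (by positivity), inv_mul_eq_div, Real.div_rpow hC (by positivity),
            ← Real.rpow_natCast, ← Real.rpow_mul hr1.le, Real.rpow_sub hr1 ((n : ℝ) - 2)]
          congr 1
          ring
  · rw [lintegral_const_mul' _ _ ENNReal.ofReal_ne_top]
    exact ENNReal.mul_lt_top ENNReal.ofReal_lt_top (lintegral_one_sub_rpow_lt_top ha)

end
end

section
/- Let n ≥ 2, let 0 < k < √2 − 1, and let x ∈ B with x ≠ 0. Then B(0, (k−k²)/(2+k)²) ⊆ T_x(B(x, k(1−|x|))) ⊆ B(0, k² + 2k). Moreover, since T_x^{-1} = T_{−x}, the analogous inclusions hold for the inverse map: B(0, (k−k²)/(2+k)²) ⊆ T_x^{-1}(B(−x, k(1−|x|))) ⊆ B(0, k² + 2k). -/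
open MeasureTheory Metric Set Filter
open scoped ENNReal NNReal Topology Classical

noncomputable section

theorem mobiusT_denominator {n : ℕ} {x : Vec n} (hx0 : x ≠ 0) (u : Vec n) :
    ‖x‖ ^ 2 * ‖x + u - (‖x‖ ^ 2)⁻¹ • x‖ ^ 2 =
      (1 - ‖x‖ ^ 2) ^ 2 - 2 * (1 - ‖x‖ ^ 2) * inner ℝ x u + ‖x‖ ^ 2 * ‖u‖ ^ 2 := by
  have ha : ‖x‖ ≠ 0 := norm_ne_zero_iff.mpr hx0
  have h : x + u - (‖x‖ ^ 2)⁻¹ • x = (1 - (‖x‖ ^ 2)⁻¹) • x + u := by module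
  rw [h, norm_add_sq_real, norm_smul, inner_smul_left, mul_pow, Real.norm_eq_abs, sq_abs]
  simp only [conj_trivial]
  field_simp
  ring

theorem mobiusT_add {n : ℕ} {x : Vec n} (hx0 : x ≠ 0) (u : Vec n) :
    mobiusT n x (x + u) =
      ((1 - ‖x‖ ^ 2) ^ 2 - 2 * (1 - ‖x‖ ^ 2) * inner ℝ x u + ‖x‖ ^ 2 * ‖u‖ ^ 2)⁻¹ •
        ((1 - ‖x‖ ^ 2) • u - ‖u‖ ^ 2 • x) := by
  rw [mobiusT, if_neg hx0, mobiusT_denominator hx0, add_sub_cancel_left]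

theorem norm_mobiusT_numerator_sq {n : ℕ} (x u : Vec n) :
    ‖(1 - ‖x‖ ^ 2) • u - ‖u‖ ^ 2 • x‖ ^ 2 = ‖u‖ ^ 2 *
      ((1 - ‖x‖ ^ 2) ^ 2 - 2 * (1 - ‖x‖ ^ 2) * inner ℝ x u + ‖x‖ ^ 2 * ‖u‖ ^ 2) := by
  rw [norm_sub_sq_real, norm_smul, norm_smul, inner_smul_left, inner_smul_right, mul_pow, mul_pow,
    Real.norm_eq_abs, Real.norm_eq_abs, sq_abs, sq_abs, real_inner_comm]
  simp only [conj_trivial]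
  ring

theorem norm_mobiusT_add_lt {n : ℕ} {x u : Vec n} (hx0 : x ≠ 0) (hx : ‖x‖ < 1) {k : ℝ}
    (hk0 : 0 < k) (hk1 : k < 1) (hu : ‖u‖ < k * (1 - ‖x‖)) :
    ‖mobiusT n x (x + u)‖ < k := by
  have ha : 0 < ‖x‖ := norm_pos_iff.mpr hx0
  have hnum := norm_mobiusT_numerator_sq x u
  rw [mobiusT_add hx0]
  have hin : inner ℝ x u ≤ ‖x‖ * ‖u‖ := real_inner_le_norm x u
  set D := (1 - ‖x‖ ^ 2) ^ 2 - 2 * (1 - ‖x‖ ^ 2) * inner ℝ x u + ‖x‖ ^ 2 * ‖u‖ ^ 2 with hD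
  have hs : 0 < 1 - ‖x‖ ^ 2 := by nlinarith
  have hDge : (1 - ‖x‖ ^ 2 - ‖x‖ * ‖u‖) ^ 2 ≤ D := by
    rw [hD]; nlinarith [mul_le_mul_of_nonneg_left hin hs.le]
  have hgap : 1 - ‖x‖ ≤ 1 - ‖x‖ ^ 2 - ‖x‖ * ‖u‖ := by
    have : ‖u‖ ≤ 1 - ‖x‖ := by nlinarith
    nlinarith [mul_le_mul_of_nonneg_left this ha.le]
  have hDsq : (1 - ‖x‖) ^ 2 ≤ D := (pow_le_pow_left₀ (by linarith) hgap 2).trans hDge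
  have hDpos : 0 < D := (pow_pos (by linarith) 2).trans_le hDsq
  refine lt_of_pow_lt_pow_left₀ 2 hk0.le ?_
  rw [norm_smul, mul_pow, hnum, Real.norm_eq_abs, sq_abs]
  have : D⁻¹ ^ 2 * (‖u‖ ^ 2 * D) = ‖u‖ ^ 2 / D := by field_simp
  rw [this, div_lt_iff₀ hDpos]
  calc ‖u‖ ^ 2 < (k * (1 - ‖x‖)) ^ 2 := pow_lt_pow_left₀ hu (norm_nonneg u) two_ne_zero
    _ = k ^ 2 * (1 - ‖x‖) ^ 2 := mul_pow _ _ _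
    _ ≤ k ^ 2 * D := by gcongr

theorem exists_mobiusT_add_eq {n : ℕ} {x w : Vec n} (hx0 : x ≠ 0) (hx : ‖x‖ < 1) {k : ℝ}
    (hk0 : 0 < k) (hw : ‖w‖ < k / (2 + k)) :
    ∃ u : Vec n, ‖u‖ < k * (1 - ‖x‖) ∧ mobiusT n x (x + u) = w := by
  have ha : 0 < ‖x‖ := norm_pos_iff.mpr hx0
  have hr : 0 ≤ ‖w‖ := norm_nonneg w
  have hs : 0 < 1 - ‖x‖ ^ 2 := by nlinarith
  rw [lt_div_iff₀ (by linarith)] at hw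
  have hin : -(‖x‖ * ‖w‖) ≤ inner ℝ x w := (abs_le.mp (abs_real_inner_le_norm x w)).1
  set E := 1 + 2 * inner ℝ x w + ‖x‖ ^ 2 * ‖w‖ ^ 2 with hE
  have hEge : (1 - ‖x‖ * ‖w‖) ^ 2 ≤ E := by rw [hE]; nlinarith
  have hw1 : ‖w‖ < 1 := by nlinarith
  have hgap : 0 < 1 - ‖x‖ * ‖w‖ := by nlinarith
  have hEpos : 0 < E := (pow_pos hgap 2).trans_le hEge
  have hnorm : ‖((1 - ‖x‖ ^ 2) / E) • (w + ‖w‖ ^ 2 • x)‖ ^ 2 =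
      (1 - ‖x‖ ^ 2) ^ 2 * ‖w‖ ^ 2 / E := by
    have h : ‖w + ‖w‖ ^ 2 • x‖ ^ 2 = ‖w‖ ^ 2 * E := by
      rw [norm_add_sq_real, norm_smul, inner_smul_right, mul_pow, Real.norm_eq_abs, sq_abs,
        real_inner_comm, hE]
      ring
    rw [norm_smul, mul_pow, h, Real.norm_eq_abs, sq_abs]
    field_simp
  refine ⟨((1 - ‖x‖ ^ 2) / E) • (w + ‖w‖ ^ 2 • x), ?_, ?_⟩
  · refine lt_of_pow_lt_pow_left₀ 2 (mul_nonneg hk0.le (by linarith)) ?_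
    rw [hnorm, div_lt_iff₀ hEpos]
    have hlt : (1 + ‖x‖) * ‖w‖ < k * (1 - ‖x‖ * ‖w‖) := by
      have h₁ : (1 + ‖x‖) * ‖w‖ ≤ 2 * ‖w‖ := by gcongr; linarith
      have h₂ : ‖x‖ * ‖w‖ ≤ 1 * ‖w‖ := by gcongr
      nlinarith
    calc (1 - ‖x‖ ^ 2) ^ 2 * ‖w‖ ^ 2 = (1 - ‖x‖) ^ 2 * ((1 + ‖x‖) * ‖w‖) ^ 2 := by ring
      _ < (1 - ‖x‖) ^ 2 * (k * (1 - ‖x‖ * ‖w‖)) ^ 2 := by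
        have : 0 < 1 - ‖x‖ := by linarith
        gcongr
      _ = (k * (1 - ‖x‖)) ^ 2 * (1 - ‖x‖ * ‖w‖) ^ 2 := by ring
      _ ≤ (k * (1 - ‖x‖)) ^ 2 * E := by gcongr
  · have hden : (1 - ‖x‖ ^ 2) ^ 2 - 2 * (1 - ‖x‖ ^ 2) *
        inner ℝ x (((1 - ‖x‖ ^ 2) / E) • (w + ‖w‖ ^ 2 • x)) +
        ‖x‖ ^ 2 * ((1 - ‖x‖ ^ 2) ^ 2 * ‖w‖ ^ 2 / E) = (1 - ‖x‖ ^ 2) ^ 2 / E := by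
      rw [inner_smul_right, inner_add_right, inner_smul_right, real_inner_self_eq_norm_sq]
      field_simp
      rw [hE]
      ring
    rw [mobiusT_add hx0, hnorm, hden, smul_smul, smul_add, smul_smul, add_sub_assoc, ← sub_smul]
    have h₁ : (1 - ‖x‖ ^ 2) * ((1 - ‖x‖ ^ 2) / E) * ‖w‖ ^ 2 -
        (1 - ‖x‖ ^ 2) ^ 2 * ‖w‖ ^ 2 / E = 0 := by ring
    have h₂ : ((1 - ‖x‖ ^ 2) ^ 2 / E)⁻¹ * ((1 - ‖x‖ ^ 2) * ((1 - ‖x‖ ^ 2) / E)) = 1 := by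
      field_simp
    rw [h₁, zero_smul, add_zero, smul_smul, h₂, one_smul]

theorem ball_subset_mobiusT_image_subset_ball {n : ℕ} {x : Vec n} (hx0 : x ≠ 0) (hx : ‖x‖ < 1)
    {k : ℝ} (hk0 : 0 < k) (hk1 : k < 1) :
    Metric.ball (0 : Vec n) (k / (2 + k)) ⊆ mobiusT n x '' Metric.ball x (k * (1 - ‖x‖)) ∧
      mobiusT n x '' Metric.ball x (k * (1 - ‖x‖)) ⊆ Metric.ball (0 : Vec n) k := by
  constructor
  · intro w hw
    obtain ⟨u, hu, h⟩ := exists_mobiusT_add_eq hx0 hx hk0 (mem_ball_zero_iff.mp hw)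
    exact ⟨x + u, by simpa [mem_ball_iff_norm] using hu, h⟩
  · rintro _ ⟨y, hy, rfl⟩
    rw [mem_ball_iff_norm] at hy
    simpa using norm_mobiusT_add_lt hx0 hx hk0 hk1 hy

theorem mobius_ball_inclusions (n : ℕ) (hn : 2 ≤ n) (k : ℝ) (hk0 : 0 < k)
    (hk : k < Real.sqrt 2 - 1) (x : Vec n) (hx : x ∈ unitBall n) (hx0 : x ≠ 0) :
    (Metric.ball (0 : Vec n) ((k - k ^ 2) / (2 + k) ^ 2) ⊆
        mobiusT n x '' Metric.ball x (k * (1 - ‖x‖)) ∧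
      mobiusT n x '' Metric.ball x (k * (1 - ‖x‖)) ⊆
        Metric.ball (0 : Vec n) (k ^ 2 + 2 * k)) ∧
    (Metric.ball (0 : Vec n) ((k - k ^ 2) / (2 + k) ^ 2) ⊆
        mobiusT n (-x) '' Metric.ball (-x) (k * (1 - ‖x‖)) ∧
      mobiusT n (-x) '' Metric.ball (-x) (k * (1 - ‖x‖)) ⊆
        Metric.ball (0 : Vec n) (k ^ 2 + 2 * k)) := by
  have hx1 : ‖x‖ < 1 := mem_ball_zero_iff.mp hx
  have hk1 : k < 1 := by
    have : Real.sqrt 2 ≤ 2 := by rw [Real.sqrt_le_left (by norm_num)]; norm_num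
    linarith
  have hsmall : (k - k ^ 2) / (2 + k) ^ 2 ≤ k / (2 + k) := by
    rw [div_le_div_iff₀ (by positivity) (by positivity)]
    have : 0 < k * (2 + k) := by positivity
    nlinarith
  have hlarge : k ≤ k ^ 2 + 2 * k := by nlinarith
  have key : ∀ z : Vec n, z ≠ 0 → ‖z‖ < 1 →
      Metric.ball (0 : Vec n) ((k - k ^ 2) / (2 + k) ^ 2) ⊆
          mobiusT n z '' Metric.ball z (k * (1 - ‖z‖)) ∧
        mobiusT n z '' Metric.ball z (k * (1 - ‖z‖)) ⊆
          Metric.ball (0 : Vec n) (k ^ 2 + 2 * k) := fun z hz0 hz1 =>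
    have h := ball_subset_mobiusT_image_subset_ball hz0 hz1 hk0 hk1
    ⟨(Metric.ball_subset_ball hsmall).trans h.1, h.2.trans (Metric.ball_subset_ball hlarge)⟩
  refine ⟨key x hx0 hx1, ?_⟩
  simpa only [norm_neg] using key (-x) (neg_ne_zero.mpr hx0) (by rwa [norm_neg])

end
end
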